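/- arXiv:2305.18754 — 4 statements merged into one kernel-verified Lean document; each statement's English description precedes it below -/
import Mathlib

section
/- Let A be a simple unital C*-algebra, let G be a finite group, and let α : G → Aut(A) be an action of G on A. Then the following are equivalent: (1) α has the weak tracial Rokhlin property; (2) for every finite subset F ⊂ A, every ε > 0, and every nonzero positive x ∈ A, there exist pairwise orthogonal positive contractions f_g ∈ A (g ∈ G) such that, with f = Σ_{g∈G} f_g: (a) ‖f_g a − a f_g‖ < ε for all g ∈ G and all a ∈ F; (b) ‖α_g(f_h) − f_{gh}‖ < ε for all g, h ∈ G; (c) 1 − f ≾ x; (d) ‖f‖ > 1 − ε; (3) for every finite subset F ⊂ A, every ε > 0, and every nonzero positive x ∈ A, there exist pairwise orthogonal positive contractions f_g ∈ A (g ∈ G) such that, with f = Σ_{g∈G} f_g, conditions (a), (b), (c) above hold and (d') ‖f a f‖ > ‖a‖ − ε for all a ∈ F. -/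
open Filter Topology

/-- Cuntz subequivalence: `a ≾ b` iff there is a sequence `vₙ` with `‖a - vₙ b vₙ*‖ → 0`. -/
def CuntzSubeq {A : Type*} [NonUnitalRing A] [StarRing A] [Norm A] (a b : A) : Prop :=
  ∃ v : ℕ → A, Filter.Tendsto (fun n => ‖a - v n * b * star (v n)‖) Filter.atTop (nhds (0 : ℝ))

/-- The weak tracial Rokhlin property for an action `α` of a finite group `G` on a
unital C*-algebra `A` (where each `α g` is moreover assumed to be a *-automorphism). -/
def HasWeakTracialRokhlin {A G : Type*} [CStarAlgebra A] [PartialOrder A] [StarOrderedRing A]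
    [Group G] [Fintype G] (α : G →* (A ≃ₐ[ℂ] A)) : Prop :=
  ∀ (F : Finset A) (ε : ℝ), 0 < ε → ∀ x : A, 0 ≤ x → ‖x‖ = 1 →
    ∃ f : G → A,
      (∀ g, 0 ≤ f g) ∧ (∀ g, ‖f g‖ ≤ 1) ∧
      (∀ g h, g ≠ h → f g * f h = 0) ∧
      (∀ g, ∀ a ∈ F, ‖f g * a - a * f g‖ < ε) ∧
      (∀ g h, ‖α g (f h) - f (g * h)‖ < ε) ∧
      CuntzSubeq ((1 : A) - ∑ g, f g) x ∧
      1 - ε < ‖(∑ g, f g) * x * (∑ g, f g)‖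

section Helpers

set_option linter.unusedSectionVars false

variable {A ι : Type*} [CStarAlgebra A] [PartialOrder A] [StarOrderedRing A]

theorem WTR.null_mul_bdd {l : Filter ι} {u v : ι → A} (C : ℝ) (hu : Tendsto u l (𝓝 0))
    (hv : ∀ i, ‖v i‖ ≤ C) : Tendsto (fun i => u i * v i) l (𝓝 0) :=
  hu.zero_mul_isBoundedUnder_le ⟨C, by simpa using Eventually.of_forall hv⟩

theorem WTR.bdd_mul_null {l : Filter ι} {u v : ι → A} (C : ℝ) (hu : ∀ i, ‖u i‖ ≤ C)
    (hv : Tendsto v l (𝓝 0)) : Tendsto (fun i => u i * v i) l (𝓝 0) :=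
  isBoundedUnder_le_mul_tendsto_zero ⟨C, by simpa using Eventually.of_forall hu⟩ hv

theorem WTR.norm_pow_le_one [Nontrivial A] {f : A} (hf : ‖f‖ ≤ 1) (n : ℕ) : ‖f ^ n‖ ≤ 1 :=
  (norm_pow_le f n).trans (pow_le_one₀ (norm_nonneg _) hf)

theorem WTR.comm_pow [Nontrivial A] {l : Filter ι} {f : ι → A} (h1 : ∀ i, ‖f i‖ ≤ 1) {s : A}
    (hs : Tendsto (fun i => f i * s - s * f i) l (𝓝 0)) (n : ℕ) :
    Tendsto (fun i => f i ^ n * s - s * f i ^ n) l (𝓝 0) := by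
  induction n with
  | zero => simpa using tendsto_const_nhds
  | succ n ih =>
    have h := (WTR.bdd_mul_null 1 (fun i => WTR.norm_pow_le_one (h1 i) n) hs).add
      (WTR.null_mul_bdd 1 ih h1)
    simp only [add_zero] at h
    refine h.congr fun i => ?_
    simp only [pow_succ]
    noncomm_ring

/-- `((faf)^* (faf))^k` is asymptotically `f^{4k} (a^* a)^k`. -/
theorem WTR.asymp [Nontrivial A] {l : Filter ι} {f : ι → A} (h0 : ∀ i, 0 ≤ f i)
    (h1 : ∀ i, ‖f i‖ ≤ 1)
    (hs : ∀ s : A, Tendsto (fun i => f i * s - s * f i) l (𝓝 0)) (a : A) (k : ℕ) :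
    Tendsto (fun i => (star (f i * a * f i) * (f i * a * f i)) ^ k
      - f i ^ (4 * k) * (star a * a) ^ k) l (𝓝 0) := by
  have hfa : ∀ i, ‖f i * a * f i‖ ≤ ‖a‖ := fun i => by
    calc ‖f i * a * f i‖ ≤ ‖f i‖ * ‖a‖ * ‖f i‖ := norm_mul₃_le
      _ ≤ 1 * ‖a‖ * 1 := by gcongr <;> exact h1 i
      _ = ‖a‖ := by ring
  have hX : ∀ i, ‖star (f i * a * f i) * (f i * a * f i)‖ ≤ ‖a‖ * ‖a‖ := fun i => by
    rw [CStarRing.norm_star_mul_self]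
    gcongr <;> exact hfa i
  have hbase : Tendsto (fun i => star (f i * a * f i) * (f i * a * f i)
      - f i ^ 4 * (star a * a)) l (𝓝 0) := by
    have e1 := WTR.bdd_mul_null (u := fun i => f i * star a * f i ^ 2) (‖a‖) (fun i => by
      calc ‖f i * star a * f i ^ 2‖ ≤ ‖f i‖ * ‖star a‖ * ‖f i ^ 2‖ := norm_mul₃_le
        _ ≤ 1 * ‖a‖ * 1 := by
          rw [norm_star]
          gcongr
          · exact h1 i
          · exact WTR.norm_pow_le_one (h1 i) 2
        _ = ‖a‖ := by ring) (hs a)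
    have e2 := (WTR.bdd_mul_null 1 h1 (WTR.comm_pow h1 (hs (star a)) 3)).mul_const a
    have h := e1.add e2
    simp only [zero_mul, add_zero] at h
    have h := h.neg
    simp only [neg_zero] at h
    refine h.congr fun i => ?_
    have hst : star (f i) = f i := (IsSelfAdjoint.of_nonneg (h0 i)).star_eq
    simp only [star_mul, hst]
    noncomm_ring
  induction k with
  | zero => simpa using tendsto_const_nhds
  | succ k ih =>
    have e1 := WTR.null_mul_bdd _ ih hX
    have e2 := WTR.bdd_mul_null (u := fun i => f i ^ (4 * k) * (star a * a) ^ k)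
      (‖(star a * a) ^ k‖) (fun i => by
        refine (norm_mul_le _ _).trans ?_
        exact mul_le_of_le_one_left (norm_nonneg _) (WTR.norm_pow_le_one (h1 i) _)) hbase
    have e3 := (WTR.bdd_mul_null 1 (fun i => WTR.norm_pow_le_one (h1 i) (4 * k))
      (WTR.comm_pow h1 (hs ((star a * a) ^ k)) 4)).mul_const (star a * a)
    have h := (e1.add e2).sub e3
    simp only [zero_mul, add_zero, sub_zero] at h
    refine h.congr fun i => ?_
    rw [pow_succ (star (f i * a * f i) * (f i * a * f i)), pow_succ (star a * a),
      show 4 * (k + 1) = 4 * k + 4 by ring, pow_add]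
    generalize star (f i * a * f i) * (f i * a * f i) = X
    generalize X ^ k = Xk
    generalize (star a * a) ^ k = yk
    generalize f i ^ (4 * k) = fk
    generalize f i ^ 4 = f4
    noncomm_ring

theorem WTR.bump [Nontrivial A] (y : A) (hy : 0 ≤ y) (t : ℝ) (ht : 0 < t) (hty : t < ‖y‖) :
    ∃ b : A, b ≠ 0 ∧ ∀ k : ℕ, ∃ u : A, ‖u‖ ≤ ‖y‖ ∧ (t ^ k : ℝ) • b = y ^ k * u := by
  have hsa : IsSelfAdjoint y := IsSelfAdjoint.of_nonneg hy
  have hmt : ∀ s : ℝ, max s t ≠ 0 := fun s => (lt_max_of_lt_right ht).ne'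
  refine ⟨cfc (fun s : ℝ => max (s - t) 0) y, ?_, fun k => ?_⟩
  · intro hb
    have h := norm_apply_le_norm_cfc (fun s : ℝ => max (s - t) 0) y
      (CStarAlgebra.norm_mem_spectrum_of_nonneg hy) (by fun_prop) hsa
    rw [hb, norm_zero, Real.norm_eq_abs] at h
    have h2 : max (‖y‖ - t) 0 = 0 := abs_nonpos_iff.mp h
    have := le_max_left (‖y‖ - t) 0
    linarith
  · have hc : Continuous (fun s : ℝ => max (s - t) 0 * (t / max s t) ^ k) := by
      have : Continuous (fun s : ℝ => t / max s t) :=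
        continuous_const.div (by fun_prop) hmt
      fun_prop
    refine ⟨cfc (fun s : ℝ => max (s - t) 0 * (t / max s t) ^ k) y, ?_, ?_⟩
    · refine norm_cfc_le (norm_nonneg _) fun s hs => ?_
      have hsy : s ≤ ‖y‖ := (le_abs_self s).trans (spectrum.norm_le_norm_of_mem hs)
      have h1 : t / max s t ≤ 1 := (div_le_one (lt_max_of_lt_right ht)).2 (le_max_right _ _)
      have h0 : 0 ≤ t / max s t := by positivity
      rw [Real.norm_eq_abs, abs_of_nonneg (by positivity)]
      calc max (s - t) 0 * (t / max s t) ^ k ≤ max (s - t) 0 * 1 := by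
            gcongr
            exact pow_le_one₀ h0 h1
        _ ≤ ‖y‖ := by
            rw [mul_one]
            exact max_le (by linarith) (norm_nonneg _)
    · rw [← cfc_pow_id (R := ℝ) y k hsa, ← cfc_mul _ _ y (by fun_prop) hc.continuousOn,
        ← cfc_smul _ _ y (by fun_prop)]
      congr 1
      funext s
      rcases le_or_gt s t with h | h
      · simp [max_eq_right (sub_nonpos.2 h)]
      · rw [max_eq_left h.le, div_pow, smul_eq_mul]
        have : s ≠ 0 := (ht.trans h).ne'
        field_simp

/-- Key lemma: in a simple algebra, asymptotically central positive contractions of norm tending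
to one are asymptotically norm preserving. -/
theorem WTR.key [Nontrivial A]
    (hA : ∀ I : TwoSidedIdeal A, IsClosed (I : Set A) → I = ⊥ ∨ I = ⊤)
    {l : Filter ι} {f : ι → A} (h0 : ∀ i, 0 ≤ f i)
    (h1 : ∀ i, ‖f i‖ ≤ 1) (hn : Tendsto (fun i => ‖f i‖) l (𝓝 1))
    (hs : ∀ s : A, Tendsto (fun i => f i * s - s * f i) l (𝓝 0)) (a : A) (ε : ℝ) (hε : 0 < ε) :
    ∀ᶠ i in l, ‖a‖ - ε < ‖f i * a * f i‖ := by
  by_contra hcon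
  have hfr : ∃ᶠ i in l, ‖f i * a * f i‖ ≤ ‖a‖ - ε := by
    exact (Filter.not_eventually.1 hcon).mono fun i hi => not_lt.1 hi
  set l' := l ⊓ 𝓟 {i | ‖f i * a * f i‖ ≤ ‖a‖ - ε} with hl'
  have hne : l'.NeBot := Filter.frequently_mem_iff_neBot.1 hfr
  have hle : l' ≤ l := inf_le_left
  have hbad : ∀ᶠ i in l', ‖f i * a * f i‖ ≤ ‖a‖ - ε :=
    Filter.mem_inf_of_right (Filter.mem_principal_self _)
  replace hn := hn.mono_left hle
  replace hs := fun s => (hs s).mono_left hle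
  obtain ⟨i0, hi0⟩ := hbad.exists
  have hT : 0 ≤ ‖a‖ - ε := (norm_nonneg _).trans hi0
  set T := ‖a‖ - ε with hTdef
  have hTa : T ^ 2 < ‖a‖ ^ 2 := by nlinarith [norm_nonneg a]
  obtain ⟨t, htT, hta⟩ := exists_between hTa
  have ht : 0 < t := lt_of_le_of_lt (sq_nonneg T) htT
  have hy : (0 : A) ≤ star a * a := star_mul_self_nonneg a
  have hny : ‖star a * a‖ = ‖a‖ ^ 2 := by rw [CStarRing.norm_star_mul_self, sq]
  obtain ⟨b, hb0, hb⟩ := WTR.bump (star a * a) hy t ht (by rwa [hny])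
  let L : Filter (ℕ × ι) := (atTop : Filter ℕ).curry l'
  let E : ℕ × ι → A := fun p => f p.2 ^ (4 * 2 ^ p.1)
  have hE1 : ∀ p, ‖E p‖ ≤ 1 := fun p => WTR.norm_pow_le_one (h1 p.2) _
  have hcomm : ∀ s, Tendsto (fun p => s * E p - E p * s) L (𝓝 0) := fun s => by
    have : Tendsto (↿(fun (n : ℕ) (i : ι) => s * f i ^ (4 * 2 ^ n) - f i ^ (4 * 2 ^ n) * s))
        L (𝓝 0) := by
      refine Tendsto.curry (Eventually.of_forall fun n => ?_)
      simpa using (WTR.comm_pow h1 (hs s) (4 * 2 ^ n)).neg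
    exact this
  let J : TwoSidedIdeal A := TwoSidedIdeal.mk' {b | Tendsto (fun p => E p * b) L (𝓝 0)}
    (by simpa using tendsto_const_nhds)
    (by
      intro x y hx hy
      have := Tendsto.add hx hy
      simpa [mul_add] using this)
    (by
      intro x hx
      have := Tendsto.neg hx
      simpa using this)
    (by
      intro x y hy
      have e1 := Tendsto.const_mul x hy
      have e2 := (hcomm x).mul_const y
      have := e1.sub e2
      simp only [mul_zero, zero_mul, sub_zero] at this
      refine this.congr fun p => ?_
      noncomm_ring)
    (by
      intro x y hx
      have := Tendsto.mul_const y hx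
      simpa [mul_assoc] using this)
  have hJ : ∀ x, x ∈ J ↔ Tendsto (fun p => E p * x) L (𝓝 0) := fun x => by
    simp only [J, TwoSidedIdeal.mem_mk', Set.mem_ofPred_eq]
  have hclosed : IsClosed (J : Set A) := by
    refine isClosed_of_closure_subset fun x hx => ?_
    rw [SetLike.mem_coe, hJ, Metric.tendsto_nhds]
    intro η hη
    obtain ⟨z, hz, hxz⟩ := Metric.mem_closure_iff.1 hx (η / 2) (by positivity)
    rw [SetLike.mem_coe, hJ, Metric.tendsto_nhds] at hz
    filter_upwards [hz (η / 2) (by positivity)] with p hp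
    rw [dist_zero_right] at hp ⊢
    rw [dist_eq_norm] at hxz
    calc ‖E p * x‖ = ‖E p * (x - z) + E p * z‖ := by rw [← mul_add, sub_add_cancel]
      _ ≤ ‖E p * (x - z)‖ + ‖E p * z‖ := norm_add_le _ _
      _ ≤ ‖x - z‖ + ‖E p * z‖ := by
        gcongr
        exact (norm_mul_le _ _).trans (mul_le_of_le_one_left (norm_nonneg _) (hE1 p))
      _ < η := by linarith
  have hbJ : b ∈ J := by
    rw [hJ, Metric.tendsto_nhds]
    intro η hη
    refine Filter.eventually_curry_iff.2 ?_
    have hlim : Tendsto (fun n : ℕ => (T ^ 2 / t) ^ (2 ^ n) * ‖star a * a‖) atTop (𝓝 0) := by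
      have hr : Tendsto (fun k : ℕ => (T ^ 2 / t) ^ k) atTop (𝓝 0) :=
        tendsto_pow_atTop_nhds_zero_of_lt_one (by positivity) ((div_lt_one ht).2 htT)
      have := (hr.comp (tendsto_pow_atTop_atTop_of_one_lt (one_lt_two : 1 < 2))).mul_const
        ‖star a * a‖
      simpa using this
    filter_upwards [hlim.eventually (gt_mem_nhds (half_pos hη))] with n hn
    have has := (WTR.asymp h0 h1 hs a (2 ^ n)).norm
    rw [norm_zero] at has
    have hpos : 0 < η / 2 * t ^ (2 ^ n) / (‖star a * a‖ + 1) := by positivity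
    filter_upwards [has.eventually (gt_mem_nhds hpos), hbad] with i hi hbi
    rw [dist_zero_right]
    change ‖f i ^ (4 * 2 ^ n) * b‖ < η
    obtain ⟨u, hu, hub⟩ := hb (2 ^ n)
    set k := 2 ^ n
    set N := ‖star a * a‖
    have hN : 0 ≤ N := norm_nonneg _
    have htk : 0 < t ^ k := by positivity
    have hXk : ‖(star (f i * a * f i) * (f i * a * f i)) ^ k‖ ≤ (T ^ 2) ^ k := by
      refine (norm_pow_le _ _).trans ?_
      rw [CStarRing.norm_star_mul_self, ← sq]
      gcongr
    have h3 : ‖f i ^ (4 * k) * (star a * a) ^ k‖ ≤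
        (T ^ 2) ^ k + η / 2 * t ^ k / (N + 1) := by
      have := norm_sub_norm_le (f i ^ (4 * k) * (star a * a) ^ k)
        ((star (f i * a * f i) * (f i * a * f i)) ^ k)
      rw [norm_sub_rev] at this
      linarith
    have h4 : t ^ k * ‖f i ^ (4 * k) * b‖ ≤ ((T ^ 2) ^ k + η / 2 * t ^ k / (N + 1)) * N := by
      calc t ^ k * ‖f i ^ (4 * k) * b‖ = ‖f i ^ (4 * k) * ((t ^ k : ℝ) • b)‖ := by
            rw [mul_smul_comm, norm_smul, Real.norm_of_nonneg htk.le]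
        _ = ‖f i ^ (4 * k) * (star a * a) ^ k * u‖ := by rw [hub, mul_assoc]
        _ ≤ ‖f i ^ (4 * k) * (star a * a) ^ k‖ * ‖u‖ := norm_mul_le _ _
        _ ≤ _ := by gcongr
    have h5 : (T ^ 2) ^ k * N < η / 2 * t ^ k := by
      rw [div_pow, div_mul_eq_mul_div, div_lt_iff₀ htk] at hn
      exact hn
    have h6 : η / 2 * t ^ k / (N + 1) * N ≤ η / 2 * t ^ k := by
      rw [div_mul_eq_mul_div, div_le_iff₀ (by positivity)]
      have : 0 < η / 2 * t ^ k := by positivity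
      nlinarith
    have h7 : t ^ k * ‖f i ^ (4 * k) * b‖ < t ^ k * η := by nlinarith
    exact lt_of_mul_lt_mul_left h7 htk.le
  have h1J : (1 : A) ∉ J := by
    rw [hJ, Metric.tendsto_nhds]
    intro h
    have h := Filter.eventually_curry_iff.1 (h (1 / 2) (by norm_num))
    obtain ⟨n, hnn⟩ := h.exists
    have hp : Tendsto (fun i => ‖f i‖ ^ (2 ^ (n + 2))) l' (𝓝 1) := by
      simpa using hn.pow (2 ^ (n + 2))
    obtain ⟨i, hi, hi'⟩ := (hnn.and (hp.eventually (lt_mem_nhds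
      (by norm_num : (1 / 2 : ℝ) < 1)))).exists
    rw [dist_zero_right, mul_one] at hi
    change ‖f i ^ (4 * 2 ^ n)‖ < 1 / 2 at hi
    rw [show 4 * 2 ^ n = 2 ^ (n + 2) by ring,
      (IsSelfAdjoint.of_nonneg (h0 i)).norm_pow_two_pow] at hi
    linarith
  rcases hA J hclosed with h | h
  · rw [h, TwoSidedIdeal.mem_bot] at hbJ
    exact hb0 hbJ
  · exact h1J (h ▸ TwoSidedIdeal.mem_top _)

theorem WTR.norm_sum_le {G : Type*} [Fintype G] (f : G → A) (h0 : ∀ g, 0 ≤ f g)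
    (h1 : ∀ g, ‖f g‖ ≤ 1) (ho : ∀ g h, g ≠ h → f g * f h = 0) : ‖∑ g, f g‖ ≤ 1 := by
  have h := IsSelfAdjoint.nnnorm_sum_eq_sup (f := f) Finset.univ
    (fun i _ => IsSelfAdjoint.of_nonneg (h0 i)) (fun g h hgh => ho g h hgh)
  have h2 : ‖∑ g, f g‖₊ ≤ 1 := by
    rw [h]
    exact Finset.sup_le fun g _ => h1 g
  exact h2

theorem WTR.cuntz_smul {a x : A} (r : ℝ) (hr : 0 < r) (h : CuntzSubeq a (r • x)) :
    CuntzSubeq a x := by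
  obtain ⟨v, hv⟩ := h
  refine ⟨fun n => Real.sqrt r • v n, hv.congr fun n => ?_⟩
  congr 2
  rw [star_smul, smul_mul_assoc, smul_mul_smul_comm, star_trivial (Real.sqrt r), Real.mul_self_sqrt hr.le,
    mul_smul_comm, smul_mul_assoc]

end Helpers

theorem weakTracialRokhlin_iff_norm_f_iff_norm_faf
    {A G : Type*} [CStarAlgebra A] [PartialOrder A] [StarOrderedRing A]
    (hA : ∀ I : TwoSidedIdeal A, IsClosed (I : Set A) → I = ⊥ ∨ I = ⊤)
    [Group G] [Fintype G] (α : G →* (A ≃ₐ[ℂ] A))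
    (hα : ∀ (g : G) (a : A), α g (star a) = star (α g a)) :
    (HasWeakTracialRokhlin α ↔
      ∀ (F : Finset A) (ε : ℝ), 0 < ε → ∀ x : A, 0 ≤ x → x ≠ 0 →
        ∃ f : G → A,
          (∀ g, 0 ≤ f g) ∧ (∀ g, ‖f g‖ ≤ 1) ∧
          (∀ g h, g ≠ h → f g * f h = 0) ∧
          (∀ g, ∀ a ∈ F, ‖f g * a - a * f g‖ < ε) ∧
          (∀ g h, ‖α g (f h) - f (g * h)‖ < ε) ∧
          CuntzSubeq ((1 : A) - ∑ g, f g) x ∧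
          1 - ε < ‖∑ g, f g‖) ∧
    (HasWeakTracialRokhlin α ↔
      ∀ (F : Finset A) (ε : ℝ), 0 < ε → ∀ x : A, 0 ≤ x → x ≠ 0 →
        ∃ f : G → A,
          (∀ g, 0 ≤ f g) ∧ (∀ g, ‖f g‖ ≤ 1) ∧
          (∀ g h, g ≠ h → f g * f h = 0) ∧
          (∀ g, ∀ a ∈ F, ‖f g * a - a * f g‖ < ε) ∧
          (∀ g h, ‖α g (f h) - f (g * h)‖ < ε) ∧
          CuntzSubeq ((1 : A) - ∑ g, f g) x ∧
          (∀ a ∈ F, ‖a‖ - ε < ‖(∑ g, f g) * a * (∑ g, f g)‖)) := by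
  have h12 : HasWeakTracialRokhlin α → ∀ (F : Finset A) (ε : ℝ), 0 < ε → ∀ x : A, 0 ≤ x → x ≠ 0 →
        ∃ f : G → A,
          (∀ g, 0 ≤ f g) ∧ (∀ g, ‖f g‖ ≤ 1) ∧
          (∀ g h, g ≠ h → f g * f h = 0) ∧
          (∀ g, ∀ a ∈ F, ‖f g * a - a * f g‖ < ε) ∧
          (∀ g h, ‖α g (f h) - f (g * h)‖ < ε) ∧
          CuntzSubeq ((1 : A) - ∑ g, f g) x ∧
          1 - ε < ‖∑ g, f g‖ := by
    intro H F ε hε x hx hx0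
    have hnx : 0 < ‖x‖ := norm_pos_iff.2 hx0
    have hy1 : ‖(‖x‖⁻¹ : ℝ) • x‖ = 1 := by
      rw [norm_smul, norm_inv, norm_norm, inv_mul_cancel₀ hnx.ne']
    obtain ⟨f, p1, p2, p3, p4, p5, p6, p7⟩ := H F ε hε ((‖x‖⁻¹ : ℝ) • x)
      (smul_nonneg (by positivity) hx) hy1
    refine ⟨f, p1, p2, p3, p4, p5, WTR.cuntz_smul _ (by positivity) p6, ?_⟩
    have hle := WTR.norm_sum_le f p1 p2 p3
    refine p7.trans_le ?_
    calc _ ≤ ‖∑ g, f g‖ * ‖(‖x‖⁻¹ : ℝ) • x‖ * ‖∑ g, f g‖ := norm_mul₃_le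
      _ ≤ 1 * ‖∑ g, f g‖ := by
        rw [hy1, mul_one]
        gcongr
      _ = _ := one_mul _
  have h23 : (∀ (F : Finset A) (ε : ℝ), 0 < ε → ∀ x : A, 0 ≤ x → x ≠ 0 →
        ∃ f : G → A,
          (∀ g, 0 ≤ f g) ∧ (∀ g, ‖f g‖ ≤ 1) ∧
          (∀ g h, g ≠ h → f g * f h = 0) ∧
          (∀ g, ∀ a ∈ F, ‖f g * a - a * f g‖ < ε) ∧
          (∀ g h, ‖α g (f h) - f (g * h)‖ < ε) ∧
          CuntzSubeq ((1 : A) - ∑ g, f g) x ∧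
          1 - ε < ‖∑ g, f g‖) →
      ∀ (F : Finset A) (ε : ℝ), 0 < ε → ∀ x : A, 0 ≤ x → x ≠ 0 →
        ∃ f : G → A,
          (∀ g, 0 ≤ f g) ∧ (∀ g, ‖f g‖ ≤ 1) ∧
          (∀ g h, g ≠ h → f g * f h = 0) ∧
          (∀ g, ∀ a ∈ F, ‖f g * a - a * f g‖ < ε) ∧
          (∀ g h, ‖α g (f h) - f (g * h)‖ < ε) ∧
          CuntzSubeq ((1 : A) - ∑ g, f g) x ∧
          (∀ a ∈ F, ‖a‖ - ε < ‖(∑ g, f g) * a * (∑ g, f g)‖) := by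
    classical
    intro H F ε hε x hx hx0
    have : Nontrivial A := ⟨x, 0, hx0⟩
    have H' := fun p : Finset A × ℕ => H (F ∪ p.1) (min ε (1 / ((p.2 : ℝ) + 1)))
      (by positivity) x hx hx0
    choose f p1 p2 p3 p4 p5 p6 p7 using H'
    have hlim : Tendsto (fun p : Finset A × ℕ => 1 / ((p.2 : ℝ) + 1)) atTop (𝓝 0) := by
      rw [← Filter.prod_atTop_atTop_eq]
      exact tendsto_one_div_add_atTop_nhds_zero_nat.comp tendsto_snd
    have hle : ∀ p, ‖∑ g, f p g‖ ≤ 1 := fun p => WTR.norm_sum_le _ (p1 p) (p2 p) (p3 p)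
    have hn : Tendsto (fun p => ‖∑ g, f p g‖) atTop (𝓝 1) := by
      refine tendsto_of_tendsto_of_tendsto_of_le_of_le
        (by simpa using tendsto_const_nhds.sub hlim : Tendsto
          (fun p : Finset A × ℕ => 1 - 1 / ((p.2 : ℝ) + 1)) atTop (𝓝 1))
        tendsto_const_nhds (fun p => ?_) hle
      have h1 := p7 p
      have h2 := min_le_right ε (1 / ((p.2 : ℝ) + 1))
      change 1 - 1 / ((p.2 : ℝ) + 1) ≤ ‖∑ g, f p g‖
      linarith
    have hs : ∀ s : A, Tendsto (fun p => (∑ g, f p g) * s - s * ∑ g, f p g) atTop (𝓝 0) := by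
      intro s
      have hg : ∀ g, Tendsto (fun p => f p g * s - s * f p g) atTop (𝓝 0) := fun g => by
        refine squeeze_zero_norm' ?_ hlim
        filter_upwards [eventually_ge_atTop (({s}, 0) : Finset A × ℕ)] with p hp
        have hsp : s ∈ p.1 := hp.1 (Finset.mem_singleton_self s)
        exact ((p4 p g s (Finset.mem_union_right _ hsp)).le).trans (min_le_right _ _)
      have := tendsto_finsetSum Finset.univ fun g _ => hg g
      simpa [Finset.sum_mul, Finset.mul_sum, Finset.sum_sub_distrib] using this
    have hkey : ∀ᶠ p in (atTop : Filter (Finset A × ℕ)), ∀ a ∈ F,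
        ‖a‖ - ε < ‖(∑ g, f p g) * a * (∑ g, f p g)‖ := by
      rw [Filter.eventually_all_finset]
      intro a _
      exact WTR.key hA (fun p => Finset.sum_nonneg fun g _ => p1 p g) hle hn hs a ε hε
    obtain ⟨p, hp⟩ := hkey.exists
    exact ⟨f p, p1 p, p2 p, p3 p,
      fun g a ha => (p4 p g a (Finset.mem_union_left _ ha)).trans_le (min_le_left _ _),
      fun g h => (p5 p g h).trans_le (min_le_left _ _), p6 p, hp⟩
  have h31 : (∀ (F : Finset A) (ε : ℝ), 0 < ε → ∀ x : A, 0 ≤ x → x ≠ 0 →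
        ∃ f : G → A,
          (∀ g, 0 ≤ f g) ∧ (∀ g, ‖f g‖ ≤ 1) ∧
          (∀ g h, g ≠ h → f g * f h = 0) ∧
          (∀ g, ∀ a ∈ F, ‖f g * a - a * f g‖ < ε) ∧
          (∀ g h, ‖α g (f h) - f (g * h)‖ < ε) ∧
          CuntzSubeq ((1 : A) - ∑ g, f g) x ∧
          (∀ a ∈ F, ‖a‖ - ε < ‖(∑ g, f g) * a * (∑ g, f g)‖)) → HasWeakTracialRokhlin α := by
    classical
    intro H F ε hε x hx hx1
    obtain ⟨f, p1, p2, p3, p4, p5, p6, p7⟩ := H (insert x F) ε hε x hx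
      (norm_pos_iff.1 (by rw [hx1]; norm_num))
    refine ⟨f, p1, p2, p3, fun g a ha => p4 g a (Finset.mem_insert_of_mem ha), p5, p6, ?_⟩
    have := p7 x (Finset.mem_insert_self _ _)
    rwa [hx1] at this
  exact ⟨⟨h12, fun h => h31 (h23 h)⟩, ⟨fun h => h23 (h12 h), h31⟩⟩
end

section
/- Let A be a simple unital C*-algebra, let G be a finite group, and let α : G → Aut(A) be an action of G on A. Then the following are equivalent: (1) α has the tracial Rokhlin property; (2) for every finite subset F ⊂ A, every ε > 0, and every nonzero positive x ∈ A, there exist pairwise orthogonal projections f_g ∈ A (g ∈ G) such that, with f = Σ_{g∈G} f_g: (a) ‖f_g a − a f_g‖ < ε for all g ∈ G and all a ∈ F; (b) ‖α_g(f_h) − f_{gh}‖ < ε for all g, h ∈ G; (c) 1 − f ≾ x; (d) ‖f‖ > 1 − ε; (3) for every finite subset F ⊂ A, every ε > 0, and every nonzero positive x ∈ A, there exist pairwise orthogonal projections f_g ∈ A (g ∈ G) such that, with f = Σ_{g∈G} f_g, conditions (a), (b), (c) above hold and (d') ‖f a f‖ > ‖a‖ − ε for all a ∈ F. -/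
open Filter Topology

/-- A projection in a C*-algebra: a self-adjoint idempotent. -/
def IsProjection {A : Type*} [Mul A] [Star A] (p : A) : Prop :=
  star p = p ∧ p * p = p

/-- The tracial Rokhlin property for an action `α` of a finite group `G` on a
unital C*-algebra `A` (where each `α g` is moreover assumed to be a *-automorphism). -/
def HasTracialRokhlin {A G : Type*} [CStarAlgebra A] [PartialOrder A] [StarOrderedRing A]
    [Group G] [Fintype G] (α : G →* (A ≃ₐ[ℂ] A)) : Prop :=
  ∀ (F : Finset A) (ε : ℝ), 0 < ε → ∀ x : A, 0 ≤ x → ‖x‖ = 1 →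
    ∃ f : G → A,
      (∀ g, IsProjection (f g)) ∧
      (∀ g h, g ≠ h → f g * f h = 0) ∧
      (∀ g, ∀ a ∈ F, ‖f g * a - a * f g‖ < ε) ∧
      (∀ g h, ‖α g (f h) - f (g * h)‖ < ε) ∧
      CuntzSubeq ((1 : A) - ∑ g, f g) x ∧
      1 - ε < ‖(∑ g, f g) * x * (∑ g, f g)‖

theorem aux_h {A : Type*} [CStarAlgebra A] [PartialOrder A] [StarOrderedRing A]
    (a : A) (r : ℝ) (hr : 0 < r) (hra : r < ‖a‖) :
    ∃ h : A, star h = h ∧ h ≠ 0 ∧ ∀ f : A, r * ‖h * f‖ ≤ ‖a * h * f‖ := by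
  have : Nontrivial A := ⟨a, 0, by rintro rfl; simp at hra; linarith⟩
  set c := star a * a with hc
  have hc0 : 0 ≤ c := star_mul_self_nonneg a
  have hcs : IsSelfAdjoint c := hc0.isSelfAdjoint
  set φ : ℝ → ℝ := fun t => max 0 (t - r ^ 2) with hφ
  have hφc : Continuous φ := by fun_prop
  have hsa : IsSelfAdjoint (cfc φ c) := cfc_predicate φ c
  refine ⟨cfc φ c, hsa, ?_, ?_⟩
  · intro h0
    have h1 : (spectrum ℝ c).EqOn φ 0 := by
      apply (cfc_eq_cfc_iff_eqOn (a := c) (f := φ) (g := 0) (by cfc_tac) (by cfc_cont_tac)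
        (by exact continuousOn_const)).1
      rw [h0]; exact (cfc_const_zero ℝ c).symm
    have h2 : ‖c‖ ∈ spectrum ℝ c := CStarAlgebra.norm_mem_spectrum_of_nonneg hc0
    have h3 := h1 h2
    simp only [hφ, Pi.zero_apply, hc, CStarRing.norm_star_mul_self] at h3
    have h4 := le_max_right 0 (‖a‖ * ‖a‖ - r ^ 2)
    nlinarith
  · intro f
    set h := cfc φ c with hh
    have key : 0 ≤ h * c * h - (r ^ 2 : ℝ) • (h * h) := by
      have : h * c * h - (r ^ 2 : ℝ) • (h * h) = cfc (fun t => φ t * t * φ t - r ^ 2 • (φ t * φ t)) c := by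
        rw [cfc_sub _ _ c, cfc_mul _ _ c, cfc_mul _ _ c, cfc_smul _ _ c, cfc_mul _ _ c, cfc_id' ℝ c]
      rw [this]
      apply cfc_nonneg
      intro t _
      simp only [hφ, smul_eq_mul]
      rcases le_total 0 (t - r ^ 2) with h | h
      · rw [max_eq_right h]
        have : (t - r ^ 2) * t * (t - r ^ 2) - r ^ 2 * ((t - r ^ 2) * (t - r ^ 2)) = (t - r^2)^3 := by ring
        rw [this]; positivity
      · rw [max_eq_left h]; simp
    have key2 : (r ^ 2 : ℝ) • (star (h * f) * (h * f)) ≤ star (a * h * f) * (a * h * f) := by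
      have := star_left_conjugate_nonneg key f
      rw [← sub_nonneg]
      convert this using 1
      simp only [star_mul, hsa.star_eq, hc, mul_sub, sub_mul, mul_assoc, smul_mul_assoc, mul_smul_comm]
    have key3 := CStarAlgebra.norm_le_norm_of_nonneg_of_le (smul_nonneg (by positivity) (star_mul_self_nonneg _)) key2
    rw [norm_smul, CStarRing.norm_star_mul_self, CStarRing.norm_star_mul_self, Real.norm_of_nonneg (by positivity)] at key3
    apply le_of_sq_le_sq _ (norm_nonneg _)
    nlinarith

theorem aux_ideal {A : Type*} [CStarAlgebra A]
    (hA : ∀ I : TwoSidedIdeal A, IsClosed (I : Set A) → I = ⊥ ∨ I = ⊤)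
    (h : A) (hh : h ≠ 0) :
    ∃ (S : Finset A) (K : ℝ), 0 < K ∧ ∀ (f : A) (δ : ℝ), ‖f‖ ≤ 1 →
      (∀ s ∈ S, ‖f * s - s * f‖ ≤ δ) → 0 ≤ δ → ‖f‖ ≤ 1 / 2 + K * (‖f * h‖ + δ) := by
  classical
  let P : Set A := {y | ∃ (S : Finset A) (K : ℝ), 0 < K ∧ ∀ (f : A) (δ : ℝ), ‖f‖ ≤ 1 →
      (∀ s ∈ S, ‖f * s - s * f‖ ≤ δ) → 0 ≤ δ → ‖f * y‖ ≤ K * (‖f * h‖ + δ)}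
  have P0 : (0 : A) ∈ P := ⟨∅, 1, one_pos, fun f δ _ _ hδ => by simp; positivity⟩
  have Ph : h ∈ P := ⟨∅, 1, one_pos, fun f δ _ _ hδ => by simp; positivity⟩
  have Padd : ∀ x ∈ P, ∀ y ∈ P, x + y ∈ P := by
    rintro x ⟨S, K, hK, hx⟩ y ⟨T, L, hL, hy⟩
    refine ⟨S ∪ T, K + L, by positivity, fun f δ hf hs hδ => ?_⟩
    have h1 := hx f δ hf (fun s h => hs s (Finset.mem_union_left _ h)) hδ
    have h2 := hy f δ hf (fun s h => hs s (Finset.mem_union_right _ h)) hδ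
    rw [mul_add]
    refine (norm_add_le _ _).trans ?_
    linarith
  have Pneg : ∀ x ∈ P, -x ∈ P := by
    rintro x ⟨S, K, hK, hx⟩
    exact ⟨S, K, hK, fun f δ hf hs hδ => by rw [mul_neg, norm_neg]; exact hx f δ hf hs hδ⟩
  have Pl : ∀ a, ∀ y ∈ P, a * y ∈ P := by
    rintro a y ⟨S, K, hK, hy⟩
    refine ⟨insert a S, ‖y‖ + (‖a‖ + 1) * K, by positivity, fun f δ hf hs hδ => ?_⟩
    have h1 := hy f δ hf (fun s h => hs s (Finset.mem_insert_of_mem h)) hδ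
    have h2 := hs a (Finset.mem_insert_self _ _)
    have : f * (a * y) = (f * a - a * f) * y + a * (f * y) := by noncomm_ring
    rw [this]
    refine (norm_add_le _ _).trans ((add_le_add (norm_mul_le _ _) (norm_mul_le _ _)).trans ?_)
    have h3 : ‖f * a - a * f‖ * ‖y‖ ≤ δ * ‖y‖ := by gcongr
    have h4 : ‖a‖ * ‖f * y‖ ≤ (‖a‖ + 1) * (K * (‖f * h‖ + δ)) := by gcongr; linarith
    have h5 : 0 ≤ ‖y‖ * ‖f * h‖ := by positivity
    nlinarith
  have Pr : ∀ y ∈ P, ∀ a, y * a ∈ P := by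
    rintro y ⟨S, K, hK, hy⟩ a
    refine ⟨S, K * (‖a‖ + 1), by positivity, fun f δ hf hs hδ => ?_⟩
    have h1 := hy f δ hf hs hδ
    rw [← mul_assoc]
    calc _ ≤ _ := norm_mul_le _ _
      _ ≤ (K * (‖f * h‖ + δ)) * (‖a‖ + 1) := by gcongr; linarith
      _ = _ := by ring
  let I : TwoSidedIdeal A := TwoSidedIdeal.mk' (closure P) (subset_closure P0)
    (fun {x y} hx hy => map_mem_closure₂ continuous_add hx hy Padd)
    (fun {x} hx => map_mem_closure continuous_neg hx Pneg)
    (fun {x y} hy => map_mem_closure (continuous_const.mul continuous_id) hy (Pl x))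
    (fun {x y} hx => map_mem_closure (f := fun z => z * y) (by fun_prop) hx (fun z hz => Pr z hz y))
  have hI : (I : Set A) = closure P := by
    ext x; simp [I]
  have hmem : (1 : A) ∈ closure P := by
    rw [← hI]
    rcases hA I (by rw [hI]; exact isClosed_closure) with h0 | h0
    · exfalso
      have : h ∈ (I : Set A) := by rw [hI]; exact subset_closure Ph
      rw [h0] at this
      exact hh (by simpa using this)
    · rw [h0]; simp
  obtain ⟨y, ⟨S, K, hK, hy⟩, hd⟩ := Metric.mem_closure_iff.1 hmem (1 / 2) (by norm_num)
  refine ⟨S, K, hK, fun f δ hf hs hδ => ?_⟩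
  have h1 := hy f δ hf hs hδ
  rw [dist_eq_norm] at hd
  have h2 : f = f * (1 - y) + f * y := by noncomm_ring
  calc ‖f‖ = ‖f * (1 - y) + f * y‖ := by rw [← h2]
    _ ≤ ‖f * (1 - y)‖ + ‖f * y‖ := norm_add_le _ _
    _ ≤ ‖f‖ * ‖1 - y‖ + ‖f * y‖ := by gcongr; exact norm_mul_le _ _
    _ ≤ 1 * (1 / 2) + K * (‖f * h‖ + δ) := by gcongr
    _ = _ := by ring

theorem aux_proj_norm {A : Type*} [CStarAlgebra A] {f : A} (hf : IsProjection f) (h0 : f ≠ 0) :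
    ‖f‖ = 1 := by
  have := CStarRing.norm_star_mul_self (x := f)
  rw [hf.1, hf.2] at this
  have h1 : ‖f‖ ≠ 0 := norm_ne_zero_iff.2 h0
  exact (mul_left_cancel₀ h1 (by linarith)).symm

theorem aux_proj_norm_le {A : Type*} [CStarAlgebra A] {f : A} (hf : IsProjection f) :
    ‖f‖ ≤ 1 := by
  by_cases h0 : f = 0
  · simp [h0]
  · exact (aux_proj_norm hf h0).le

theorem aux_one {A : Type*} [CStarAlgebra A] [PartialOrder A] [StarOrderedRing A]
    (hA : ∀ I : TwoSidedIdeal A, IsClosed (I : Set A) → I = ⊥ ∨ I = ⊤)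
    (a : A) (ε : ℝ) (hε : 0 < ε) :
    ∃ (S : Finset A) (δ : ℝ), 0 < δ ∧ ∀ f : A, IsProjection f → f ≠ 0 →
      (∀ s ∈ S, ‖f * s - s * f‖ ≤ δ) → ‖a‖ - ε < ‖f * a * f‖ := by
  classical
  by_cases hra : ‖a‖ ≤ ε / 2
  · exact ⟨∅, 1, one_pos, fun f _ _ _ => by have := norm_nonneg (f * a * f); linarith⟩
  push Not at hra
  obtain ⟨h, hs, h0, hh⟩ := aux_h a (‖a‖ - ε / 2) (by linarith) (by linarith)
  obtain ⟨S, K, hK, hS⟩ := aux_ideal hA h h0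
  obtain ⟨κ, hκ⟩ : ∃ κ, κ = 1 / (4 * K) := ⟨_, rfl⟩
  have hκ0 : 0 < κ := by rw [hκ]; positivity
  have hKκ : K * κ = 1 / 4 := by rw [hκ]; field_simp
  obtain ⟨δ, hδ⟩ : ∃ δ, δ = min κ (ε / (4 * (1 + ‖a‖ / κ))) := ⟨_, rfl⟩
  have hδ0 : 0 < δ := by rw [hδ]; positivity
  have hδκ : δ ≤ κ := by rw [hδ]; exact min_le_left _ _
  have hδε : δ * (1 + ‖a‖ / κ) ≤ ε / 4 := by
    have : δ ≤ ε / (4 * (1 + ‖a‖ / κ)) := by rw [hδ]; exact min_le_right _ _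
    have hp : 0 < 1 + ‖a‖ / κ := by positivity
    rw [le_div_iff₀ (by positivity)] at this
    linarith
  refine ⟨insert a (insert h S), δ, hδ0, fun f hf hf0 hc => ?_⟩
  have hf1 := aux_proj_norm hf hf0
  have ca := hc a (by simp)
  have ch := hc h (by simp)
  have h1 := hS f δ hf1.le (fun s hs => hc s (by simp [hs])) hδ0.le
  have hst : ‖h * f‖ = ‖f * h‖ := by rw [← norm_star (h * f), star_mul, hf.1, hs]
  rw [hf1, ← hst] at h1
  have hlow : κ ≤ ‖h * f‖ := by
    by_contra hcon
    push Not at hcon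
    nlinarith
  have h2 := hh f
  have e1 : a * h * f = (a * f) * (h * f) - a * ((f * h - h * f) * f) := by
    have : a * h * f = a * h * (f * f) := by rw [hf.2]
    rw [this]; noncomm_ring
  have h3 : ‖a * h * f‖ ≤ ‖a * f‖ * ‖h * f‖ + ‖a‖ * δ := by
    rw [e1]
    refine (norm_sub_le _ _).trans (add_le_add (norm_mul_le _ _) ((norm_mul_le _ _).trans ?_))
    gcongr
    refine (norm_mul_le _ _).trans ?_
    rw [hf1, mul_one]; exact ch
  have e2 : a * f = f * a * f - (f * a - a * f) * f := by
    have : a * f = a * (f * f) := by rw [hf.2]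
    rw [sub_mul, mul_assoc a f f, hf.2]; abel
  have h4 : ‖a * f‖ ≤ ‖f * a * f‖ + δ := by
    rw [e2]
    refine (norm_sub_le _ _).trans (add_le_add le_rfl ((norm_mul_le _ _).trans ?_))
    rw [hf1, mul_one]; exact ca
  have h5 : ‖a‖ * δ ≤ (‖a‖ / κ * δ) * ‖h * f‖ := by
    calc ‖a‖ * δ = (‖a‖ / κ * δ) * κ := by field_simp
      _ ≤ _ := by gcongr
  have h6 : (‖a‖ - ε / 2) * ‖h * f‖ ≤ (‖f * a * f‖ + δ + ‖a‖ / κ * δ) * ‖h * f‖ := by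
    have : ‖a * f‖ * ‖h * f‖ ≤ (‖f * a * f‖ + δ) * ‖h * f‖ := by gcongr
    linarith
  have h7 := le_of_mul_le_mul_right h6 (lt_of_lt_of_le hκ0 hlow)
  linarith

theorem aux_fin {A : Type*} [CStarAlgebra A] [PartialOrder A] [StarOrderedRing A]
    (hA : ∀ I : TwoSidedIdeal A, IsClosed (I : Set A) → I = ⊥ ∨ I = ⊤)
    (F : Finset A) (ε : ℝ) (hε : 0 < ε) :
    ∃ (S : Finset A) (δ : ℝ), 0 < δ ∧ ∀ f : A, IsProjection f → f ≠ 0 →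
      (∀ s ∈ S, ‖f * s - s * f‖ ≤ δ) → ∀ a ∈ F, ‖a‖ - ε < ‖f * a * f‖ := by
  classical
  induction F using Finset.induction_on with
  | empty => exact ⟨∅, 1, one_pos, by simp⟩
  | insert b F _ ih =>
    obtain ⟨S, δ, hδ, hS⟩ := ih
    obtain ⟨T, η, hη, hT⟩ := aux_one hA b ε hε
    refine ⟨S ∪ T, min δ η, lt_min hδ hη, fun f hf hf0 hc a ha => ?_⟩
    rcases Finset.mem_insert.1 ha with rfl | ha
    · exact hT f hf hf0 fun s hs =>
        (hc s (Finset.mem_union_right _ hs)).trans (min_le_right _ _)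
    · exact hS f hf hf0 (fun s hs =>
        (hc s (Finset.mem_union_left _ hs)).trans (min_le_left _ _)) a ha

theorem aux_sum_proj {A G : Type*} [CStarAlgebra A] [Fintype G] (f : G → A)
    (hp : ∀ g, IsProjection (f g)) (ho : ∀ g h, g ≠ h → f g * f h = 0) :
    IsProjection (∑ g, f g) := by
  classical
  refine ⟨by simp [star_sum, fun g => (hp g).1], ?_⟩
  rw [Finset.sum_mul]
  refine Finset.sum_congr rfl fun g _ => ?_
  rw [Finset.mul_sum, Finset.sum_eq_single g (fun h _ hh => ho g h hh.symm) (by simp)]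
  exact (hp g).2

theorem aux_cuntz_smul {A : Type*} [CStarAlgebra A] (a x : A) (t : ℝ) (ht : 0 < t)
    (h : CuntzSubeq a (t • x)) : CuntzSubeq a x := by
  obtain ⟨v, hv⟩ := h
  refine ⟨fun n => (√t) • v n, ?_⟩
  convert hv using 4 with n
  rw [star_smul, smul_mul_assoc, smul_mul_assoc, mul_smul_comm, smul_smul, star_trivial,
    Real.mul_self_sqrt ht.le, mul_smul_comm, smul_mul_assoc]

theorem tracialRokhlin_iff_norm_f_iff_norm_faf
    {A G : Type*} [CStarAlgebra A] [PartialOrder A] [StarOrderedRing A]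
    (hA : ∀ I : TwoSidedIdeal A, IsClosed (I : Set A) → I = ⊥ ∨ I = ⊤)
    [Group G] [Fintype G] (α : G →* (A ≃ₐ[ℂ] A))
    (hα : ∀ (g : G) (a : A), α g (star a) = star (α g a)) :
    (HasTracialRokhlin α ↔
      ∀ (F : Finset A) (ε : ℝ), 0 < ε → ∀ x : A, 0 ≤ x → x ≠ 0 →
        ∃ f : G → A,
          (∀ g, IsProjection (f g)) ∧
          (∀ g h, g ≠ h → f g * f h = 0) ∧
          (∀ g, ∀ a ∈ F, ‖f g * a - a * f g‖ < ε) ∧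
          (∀ g h, ‖α g (f h) - f (g * h)‖ < ε) ∧
          CuntzSubeq ((1 : A) - ∑ g, f g) x ∧
          1 - ε < ‖∑ g, f g‖) ∧
    (HasTracialRokhlin α ↔
      ∀ (F : Finset A) (ε : ℝ), 0 < ε → ∀ x : A, 0 ≤ x → x ≠ 0 →
        ∃ f : G → A,
          (∀ g, IsProjection (f g)) ∧
          (∀ g h, g ≠ h → f g * f h = 0) ∧
          (∀ g, ∀ a ∈ F, ‖f g * a - a * f g‖ < ε) ∧
          (∀ g h, ‖α g (f h) - f (g * h)‖ < ε) ∧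
          CuntzSubeq ((1 : A) - ∑ g, f g) x ∧
          (∀ a ∈ F, ‖a‖ - ε < ‖(∑ g, f g) * a * (∑ g, f g)‖)) := by
  classical
  have h12 : HasTracialRokhlin α →
      ∀ (F : Finset A) (ε : ℝ), 0 < ε → ∀ x : A, 0 ≤ x → x ≠ 0 →
        ∃ f : G → A,
          (∀ g, IsProjection (f g)) ∧
          (∀ g h, g ≠ h → f g * f h = 0) ∧
          (∀ g, ∀ a ∈ F, ‖f g * a - a * f g‖ < ε) ∧
          (∀ g h, ‖α g (f h) - f (g * h)‖ < ε) ∧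
          CuntzSubeq ((1 : A) - ∑ g, f g) x ∧
          1 - ε < ‖∑ g, f g‖ := by
    intro H F ε hε x hx hx0
    have hn : 0 < ‖x‖ := norm_pos_iff.2 hx0
    have hn1 : ‖(‖x‖⁻¹ : ℝ) • x‖ = 1 := by
      rw [norm_smul, norm_inv, norm_norm, inv_mul_cancel₀ hn.ne']
    obtain ⟨f, hp, ho, hc, hi, hs, hd⟩ := H F ε hε ((‖x‖⁻¹ : ℝ) • x)
      (smul_nonneg (by positivity) hx) hn1
    refine ⟨f, hp, ho, hc, hi, aux_cuntz_smul _ _ _ (by positivity) hs, lt_of_lt_of_le hd ?_⟩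
    have hf := aux_proj_norm_le (aux_sum_proj f hp ho)
    calc _ ≤ _ := norm_mul_le _ _
      _ ≤ (‖∑ g, f g‖ * 1) * 1 := by
        gcongr
        refine (norm_mul_le _ _).trans ?_
        rw [hn1]
      _ = _ := by ring
  have h23 : (∀ (F : Finset A) (ε : ℝ), 0 < ε → ∀ x : A, 0 ≤ x → x ≠ 0 →
        ∃ f : G → A,
          (∀ g, IsProjection (f g)) ∧
          (∀ g h, g ≠ h → f g * f h = 0) ∧
          (∀ g, ∀ a ∈ F, ‖f g * a - a * f g‖ < ε) ∧
          (∀ g h, ‖α g (f h) - f (g * h)‖ < ε) ∧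
          CuntzSubeq ((1 : A) - ∑ g, f g) x ∧
          1 - ε < ‖∑ g, f g‖) →
      ∀ (F : Finset A) (ε : ℝ), 0 < ε → ∀ x : A, 0 ≤ x → x ≠ 0 →
        ∃ f : G → A,
          (∀ g, IsProjection (f g)) ∧
          (∀ g h, g ≠ h → f g * f h = 0) ∧
          (∀ g, ∀ a ∈ F, ‖f g * a - a * f g‖ < ε) ∧
          (∀ g h, ‖α g (f h) - f (g * h)‖ < ε) ∧
          CuntzSubeq ((1 : A) - ∑ g, f g) x ∧
          (∀ a ∈ F, ‖a‖ - ε < ‖(∑ g, f g) * a * (∑ g, f g)‖) := by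
    intro H F ε hε x hx hx0
    obtain ⟨S, δ, hδ, hS⟩ := aux_fin hA F ε hε
    have hG : (0 : ℝ) < Fintype.card G := by exact_mod_cast Fintype.card_pos
    obtain ⟨η, hη⟩ : ∃ η, η = min ε (min 1 (δ / Fintype.card G)) := ⟨_, rfl⟩
    have hη0 : 0 < η := by rw [hη]; positivity
    have hηε : η ≤ ε := by rw [hη]; exact min_le_left _ _
    have hη1 : η ≤ 1 := by rw [hη]; exact (min_le_right _ _).trans (min_le_left _ _)
    have hηδ : η ≤ δ / Fintype.card G := by
      rw [hη]; exact (min_le_right _ _).trans (min_le_right _ _)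
    obtain ⟨f, hp, ho, hc, hi, hs, hd⟩ := H (F ∪ S) η hη0 x hx hx0
    refine ⟨f, hp, ho, fun g a ha => (hc g a (Finset.mem_union_left _ ha)).trans_le hηε,
      fun g h => (hi g h).trans_le hηε, hs, ?_⟩
    refine hS _ (aux_sum_proj f hp ho) ?_ fun s hs => ?_
    · rw [← norm_pos_iff]; linarith
    · rw [Finset.sum_mul, Finset.mul_sum, ← Finset.sum_sub_distrib]
      calc _ ≤ ∑ g, ‖f g * s - s * f g‖ := norm_sum_le _ _
        _ ≤ ∑ g : G, δ / Fintype.card G := Finset.sum_le_sum fun g _ =>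
          (hc g s (Finset.mem_union_right _ hs)).le.trans hηδ
        _ = δ := by
          rw [Finset.sum_const, Finset.card_univ, nsmul_eq_mul]; field_simp
  have h31 : (∀ (F : Finset A) (ε : ℝ), 0 < ε → ∀ x : A, 0 ≤ x → x ≠ 0 →
        ∃ f : G → A,
          (∀ g, IsProjection (f g)) ∧
          (∀ g h, g ≠ h → f g * f h = 0) ∧
          (∀ g, ∀ a ∈ F, ‖f g * a - a * f g‖ < ε) ∧
          (∀ g h, ‖α g (f h) - f (g * h)‖ < ε) ∧
          CuntzSubeq ((1 : A) - ∑ g, f g) x ∧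
          (∀ a ∈ F, ‖a‖ - ε < ‖(∑ g, f g) * a * (∑ g, f g)‖)) → HasTracialRokhlin α := by
    intro H F ε hε x hx hx1
    obtain ⟨f, hp, ho, hc, hi, hs, hd⟩ := H (insert x F) ε hε x hx
      (by rintro rfl; simp at hx1)
    refine ⟨f, hp, ho, fun g a ha => hc g a (Finset.mem_insert_of_mem ha), hi, hs, ?_⟩
    have := hd x (Finset.mem_insert_self _ _)
    rwa [hx1] at this
  exact ⟨⟨h12, fun h => h31 (h23 h)⟩, ⟨fun h => h23 (h12 h), h31⟩⟩
end

section
/- Let A be a simple unital C*-algebra, let G be a finite group, and let α : G → Aut(A) be an action of G on A. Then α has the generalized tracial Rokhlin property if and only if α has the weak tracial Rokhlin property. -/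
open Filter Topology

/-- The generalized tracial Rokhlin property of Hirshberg–Orovitz. -/
def HasGeneralizedTracialRokhlin {A G : Type*} [CStarAlgebra A] [PartialOrder A]
    [StarOrderedRing A] [Group G] [Fintype G] (α : G →* (A ≃ₐ[ℂ] A)) : Prop :=
  ∀ (F : Finset A) (ε : ℝ), 0 < ε → ∀ x : A, 0 ≤ x → x ≠ 0 →
    ∃ f : G → A,
      (∀ g, 0 ≤ f g) ∧ (∀ g, ‖f g‖ = 1) ∧
      (∀ g h, g ≠ h → f g * f h = 0) ∧
      (∀ g, ∀ a ∈ F, ‖f g * a - a * f g‖ < ε) ∧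
      (∀ g h, ‖α g (f h) - f (g * h)‖ < ε) ∧
      CuntzSubeq ((1 : A) - ∑ g, f g) x


section RokhlinHelpers

set_option linter.unusedSectionVars false

variable {A : Type*} [CStarAlgebra A] [PartialOrder A] [StarOrderedRing A]


theorem cuntz_iff {a b : A} :
    CuntzSubeq a b ↔ ∀ ε : ℝ, 0 < ε → ∃ v : A, ‖a - v * b * star v‖ < ε := by
  constructor
  · rintro ⟨v, hv⟩ ε hε
    obtain ⟨n, hn⟩ := (hv.eventually (gt_mem_nhds hε)).exists
    exact ⟨v n, hn⟩
  · intro h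
    choose v hv using fun n : ℕ => h (1 / ((n : ℝ) + 1)) (by positivity)
    exact ⟨v, squeeze_zero (fun n => norm_nonneg _) (fun n => (hv n).le)
      tendsto_one_div_add_atTop_nhds_zero_nat⟩

theorem le_cuntz {a b : A} (ha : 0 ≤ a) (hab : a ≤ b) {δ : ℝ} (hδ : 0 < δ) :
    ∃ v : A, ‖a - v * b * star v‖ ≤ δ := by
  have hb : 0 ≤ b := ha.trans hab
  set B : A := b + algebraMap ℝ A δ with hB
  have hδA : IsStrictlyPositive (algebraMap ℝ A δ) := by
    rw [IsStrictlyPositive.iff_of_unital]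
    refine ⟨algebraMap_nonneg A hδ.le, ?_⟩
    exact (IsUnit.mk0 δ hδ.ne').map (algebraMap ℝ A)
  have hBp : IsStrictlyPositive B := by
    rw [IsStrictlyPositive.iff_of_unital]
    have h1 : algebraMap ℝ A δ ≤ B := by rw [hB]; exact le_add_of_nonneg_left hb
    exact ⟨hδA.nonneg.trans h1, CStarAlgebra.isUnit_of_le _ h1 hδA⟩
  have haB : a ≤ B := hab.trans (by rw [hB]; exact le_add_of_nonneg_right hδA.nonneg)
  have h1 := (le_iff_norm_sqrt_mul_rpow a B ha hBp).1 haB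
  set s := CFC.sqrt a with hs
  set r := B ^ (-(1 / 2) : ℝ) with hr
  have hss : star s = s := (IsSelfAdjoint.of_nonneg (CFC.sqrt_nonneg a)).star_eq
  have hrr : star r = r := (IsSelfAdjoint.of_nonneg CFC.rpow_nonneg).star_eq
  have h2 : r * B * r = 1 := CFC.conjugate_rpow_neg_one_half B hBp
  have h3 : s * s = a := CFC.sqrt_mul_sqrt_self a ha
  refine ⟨s * r, ?_⟩
  have hbB : b = B - algebraMap ℝ A δ := by rw [hB]; abel
  have h4 : a - s * r * b * star (s * r) = δ • ((s * r) * star (s * r)) := by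
    rw [hbB, mul_sub, sub_mul, star_mul, hss, hrr]
    have : s * r * B * (r * s) = a := by
      calc s * r * B * (r * s) = s * (r * B * r) * s := by noncomm_ring
        _ = a := by rw [h2, mul_one, h3]
    rw [this, sub_sub_cancel, Algebra.algebraMap_eq_smul_one, mul_smul_comm, mul_one,
      smul_mul_assoc]
  rw [h4, norm_smul, CStarRing.norm_self_mul_star, Real.norm_of_nonneg hδ.le]
  have := norm_nonneg (s * r)
  nlinarith [mul_le_one₀ h1 this h1]

theorem cuntz_of_le {a b x : A} (ha : 0 ≤ a) (hab : a ≤ b) (h : CuntzSubeq b x) :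
    CuntzSubeq a x := by
  rw [cuntz_iff] at h ⊢
  intro ε hε
  obtain ⟨w, hw⟩ := le_cuntz ha hab (half_pos hε)
  obtain ⟨v, hv⟩ := h (ε / 2 / (‖w‖ * ‖w‖ + 1)) (by positivity)
  refine ⟨w * v, ?_⟩
  have h1 : a - w * v * x * star (w * v)
      = (a - w * b * star w) + w * (b - v * x * star v) * star w := by
    rw [star_mul]; noncomm_ring
  have h2 : ‖w * (b - v * x * star v) * star w‖ ≤ ‖w‖ * ‖b - v * x * star v‖ * ‖w‖ := by
    refine (norm_mul_le _ _).trans ?_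
    rw [norm_star]
    gcongr
    exact norm_mul_le _ _
  rw [lt_div_iff₀ (by positivity)] at hv
  rw [h1]
  have := norm_add_le (a - w * b * star w) (w * (b - v * x * star v) * star w)
  have := norm_nonneg (b - v * x * star v)
  have h5 : 0 ≤ ‖b - v * x * star v‖ := this
  by_cases h0 : ‖b - v * x * star v‖ = 0
  · rw [h0] at h2; linarith
  · have : 0 < ‖b - v * x * star v‖ := lt_of_le_of_ne h5 (Ne.symm h0)
    nlinarith

theorem cuntz_conj {b x w : A} (h : CuntzSubeq b x) : CuntzSubeq (w * b * star w) x := by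
  rw [cuntz_iff] at h ⊢
  intro ε hε
  obtain ⟨v, hv⟩ := h (ε / (‖w‖ * ‖w‖ + 1)) (by positivity)
  refine ⟨w * v, ?_⟩
  have h1 : w * b * star w - w * v * x * star (w * v)
      = w * (b - v * x * star v) * star w := by
    rw [star_mul]; noncomm_ring
  have h2 : ‖w * (b - v * x * star v) * star w‖ ≤ ‖w‖ * ‖b - v * x * star v‖ * ‖w‖ := by
    refine (norm_mul_le _ _).trans ?_
    rw [norm_star]
    gcongr
    exact norm_mul_le _ _
  rw [lt_div_iff₀ (by positivity)] at hv
  rw [h1]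
  have := norm_nonneg (b - v * x * star v)
  nlinarith

/-- Orthogonal sums of positive elements of norm at most `r` have norm at most `r`. -/
theorem norm_sum_orth_le {G : Type*} [Fintype G] {f : G → A} (h0 : ∀ g, 0 ≤ f g) {r : ℝ}
    (hr : 0 ≤ r) (h1 : ∀ g, ‖f g‖ ≤ r) (ho : ∀ g h, g ≠ h → f g * f h = 0) :
    ‖∑ g, f g‖ ≤ r := by
  classical
  have hf0 : 0 ≤ ∑ g, f g := Finset.sum_nonneg fun g _ => h0 g
  have hsq : (∑ g, f g) * (∑ g, f g) = ∑ g, f g * f g := by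
    rw [Finset.sum_mul_sum]
    refine Finset.sum_congr rfl fun g _ => ?_
    exact Finset.sum_eq_single g (fun h _ hh => ho g h hh.symm) (by simp)
  have hle : (∑ g, f g) * (∑ g, f g) ≤ r • ∑ g, f g := by
    rw [hsq, Finset.smul_sum]
    refine Finset.sum_le_sum fun g _ => ?_
    have hb : f g ≤ algebraMap ℝ A r :=
      (CStarAlgebra.norm_le_iff_le_algebraMap (f g) hr (h0 g)).1 (h1 g)
    have hs := CFC.sqrt_mul_sqrt_self (f g) (h0 g)
    have := conjugate_le_conjugate_of_nonneg hb (CFC.sqrt_nonneg (f g))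
    rw [Algebra.algebraMap_eq_smul_one, mul_smul_comm, mul_one, smul_mul_assoc, hs] at this
    refine le_trans (le_of_eq ?_) this
    generalize CFC.sqrt (f g) = s at hs
    rw [← hs]; noncomm_ring
  have hsa : IsSelfAdjoint (∑ g, f g) := .of_nonneg hf0
  have hn := CStarAlgebra.norm_le_norm_of_nonneg_of_le (hsa.mul_self_nonneg) hle
  rw [hsa.norm_mul_self, norm_smul, Real.norm_of_nonneg hr] at hn
  by_contra! hc
  nlinarith

theorem norm_sub_one_le {p : A} (h0 : 0 ≤ p) (h1 : ‖p‖ ≤ 1) : 0 ≤ 1 - p ∧ ‖1 - p‖ ≤ 1 := by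
  have h2 : p ≤ 1 := (CStarAlgebra.norm_le_one_iff_of_nonneg p h0).1 h1
  have h3 : 0 ≤ 1 - p := sub_nonneg.2 h2
  exact ⟨h3, (CStarAlgebra.norm_le_one_iff_of_nonneg _ h3).2 (sub_le_self _ h0)⟩

theorem pow_contr {p : A} (h0 : 0 ≤ p) (h1 : ‖p‖ ≤ 1) (m : ℕ) : 0 ≤ p ^ m ∧ ‖p ^ m‖ ≤ 1 := by
  refine ⟨CStarAlgebra.pow_nonneg h0 m, ?_⟩
  rcases Nat.eq_zero_or_pos m with rfl | hm
  · rw [pow_zero]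
    exact (CStarAlgebra.norm_le_one_iff_of_nonneg _ zero_le_one).2 le_rfl
  · exact (norm_pow_le' p hm).trans (pow_le_one₀ (norm_nonneg _) h1)

theorem comm_pow_le {p : A} (h0 : 0 ≤ p) (h1 : ‖p‖ ≤ 1) (a : A) (m : ℕ) :
    ‖p ^ m * a - a * p ^ m‖ ≤ m * ‖p * a - a * p‖ := by
  induction m with
  | zero => simp
  | succ m ih =>
    have : p ^ (m + 1) * a - a * p ^ (m + 1)
        = p ^ m * (p * a - a * p) + (p ^ m * a - a * p ^ m) * p := by
      rw [pow_succ]; noncomm_ring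
    rw [this]
    have e1 := norm_mul_le (p ^ m) (p * a - a * p)
    have e2 := norm_mul_le (p ^ m * a - a * p ^ m) p
    have e3 := norm_add_le (p ^ m * (p * a - a * p)) ((p ^ m * a - a * p ^ m) * p)
    have e4 := mul_le_of_le_one_left (norm_nonneg (p * a - a * p)) (pow_contr h0 h1 m).2
    have e5 := mul_le_of_le_one_right (norm_nonneg (p ^ m * a - a * p ^ m)) h1
    push_cast
    linarith

theorem pow_sub_pow_le {p q : A} (hp : ‖p‖ ≤ 1) (h0 : 0 ≤ q) (h1 : ‖q‖ ≤ 1) (m : ℕ) :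
    ‖p ^ m - q ^ m‖ ≤ m * ‖p - q‖ := by
  induction m with
  | zero => simp
  | succ m ih =>
    have : p ^ (m + 1) - q ^ (m + 1) = p * (p ^ m - q ^ m) + (p - q) * q ^ m := by
      rw [pow_succ', pow_succ']; noncomm_ring
    rw [this]
    have e1 := norm_mul_le p (p ^ m - q ^ m)
    have e2 := norm_mul_le (p - q) (q ^ m)
    have e3 := norm_add_le (p * (p ^ m - q ^ m)) ((p - q) * q ^ m)
    have e4 := mul_le_of_le_one_left (norm_nonneg (p ^ m - q ^ m)) hp
    have e5 := mul_le_of_le_one_right (norm_nonneg (p - q)) (pow_contr h0 h1 m).2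
    push_cast
    linarith

theorem real_aux {t : ℝ} (h0 : 0 ≤ t) (h1 : t ≤ 1) (m : ℕ) :
    (1 - t) ^ m * t ≤ 1 / ((m : ℝ) + 1) := by
  have key : ((m : ℝ) + 1) * ((1 - t) ^ m * t) ≤ 1 - (1 - t) ^ (m + 1) := by
    induction m with
    | zero => simp
    | succ m ih =>
      have hq : 0 ≤ (1 - t) ^ m := pow_nonneg (by linarith) m
      have := mul_le_mul_of_nonneg_left ih (show 0 ≤ 1 - t by linarith)
      push_cast
      have e1 : (1 - t) ^ (m + 1) = (1 - t) ^ m * (1 - t) := pow_succ _ _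
      have e2 : (1 - t) ^ (m + 1 + 1) = (1 - t) ^ m * (1 - t) * (1 - t) := by
        rw [pow_succ, pow_succ]
      have e3 : (1 - t) ^ (m + 1) ≤ 1 := pow_le_one₀ (by linarith) (by linarith)
      rw [e1] at this e3 ⊢
      rw [e2]
      have e4 := mul_le_mul_of_nonneg_right e3 h0
      linarith
  rw [le_div_iff₀ (by positivity)]
  have : 0 ≤ (1 - t) ^ (m + 1) := pow_nonneg (by linarith) _
  linarith

theorem norm_pow_mul_le {f : A} (h0 : 0 ≤ f) (h1 : ‖f‖ ≤ 1) (m : ℕ) :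
    ‖(1 - f) ^ m * f‖ ≤ 1 / ((m : ℝ) + 1) := by
  rcases subsingleton_or_nontrivial A with _ | _
  · rw [Subsingleton.elim ((1 - f) ^ m * f) 0, norm_zero]; positivity
  have hsa : IsSelfAdjoint f := .of_nonneg h0
  have : (1 - f) ^ m * f = cfc (fun t : ℝ => (1 - t) ^ m * t) f := by
    rw [cfc_mul (fun t : ℝ => (1 - t) ^ m) (fun t => t) f, cfc_pow (fun t : ℝ => 1 - t) m f,
      cfc_sub (fun _ : ℝ => 1) (fun t => t) f, cfc_const_one ℝ f, cfc_id' ℝ f]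
  rw [this]
  refine norm_cfc_le (by positivity) fun t ht => ?_
  have ht0 : 0 ≤ t := spectrum_nonneg_of_nonneg h0 ht
  have ht1 : t ≤ 1 := ((Real.le_norm_self t).trans (spectrum.norm_le_norm_of_mem ht)).trans h1
  rw [Real.norm_of_nonneg (mul_nonneg (pow_nonneg (by linarith) _) ht0)]
  exact real_aux ht0 ht1 m

theorem sum_q {G : Type*} [Fintype G] {f : G → A} (ho : ∀ g h, g ≠ h → f g * f h = 0) (m : ℕ) :
    ∑ g, (1 - (1 - f g) ^ m) = 1 - (1 - ∑ g, f g) ^ m := by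
  classical
  induction m with
  | zero => simp
  | succ m ih =>
    have hx : (∑ g, (1 - (1 - f g) ^ m)) * (∑ g, f g) = ∑ g, (1 - (1 - f g) ^ m) * f g := by
      rw [Finset.sum_mul_sum]
      refine Finset.sum_congr rfl fun g _ => ?_
      refine Finset.sum_eq_single g (fun h _ hh => ?_) (by simp)
      rw [← geom_sum_mul_neg, sub_sub_cancel, mul_assoc, ho g h hh.symm, mul_zero]
    have h1 : (1 - ∑ g, f g) ^ m = 1 - ∑ g, (1 - (1 - f g) ^ m) := by rw [ih]; abel
    rw [pow_succ, h1]
    have : ∀ g, 1 - (1 - f g) ^ (m + 1)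
        = (1 - (1 - f g) ^ m) + f g - (1 - (1 - f g) ^ m) * f g := by
      intro g; rw [pow_succ]; noncomm_ring
    rw [Finset.sum_congr rfl fun g _ => this g, Finset.sum_sub_distrib, Finset.sum_add_distrib,
      ← hx]
    noncomm_ring

theorem orth_q {p q : A} (h : p * q = 0) (m : ℕ) :
    (1 - (1 - p) ^ m) * (1 - (1 - q) ^ m) = 0 := by
  rw [← geom_sum_mul_neg (1 - p), ← mul_neg_geom_sum (1 - q), sub_sub_cancel, sub_sub_cancel,
    mul_assoc, ← mul_assoc p, h, zero_mul, mul_zero]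

/-- Almost central contractions of norm one cannot be almost orthogonal to a nonzero element of a
simple algebra. -/
theorem central_lower_bound
    (hA : ∀ I : TwoSidedIdeal A, IsClosed (I : Set A) → I = ⊥ ∨ I = ⊤) {k : A} (hk : k ≠ 0) :
    ∃ (F : Finset A) (δ : ℝ), 0 < δ ∧ ∀ f : A, ‖f‖ = 1 → (∀ a ∈ F, ‖f * a - a * f‖ < δ) →
      δ < ‖f * k‖ := by
  classical
  let P : Finset A → ℝ → A → Prop := fun F δ f =>
    ‖f‖ = 1 ∧ (∀ a ∈ F, ‖f * a - a * f‖ < δ) ∧ ‖f * k‖ ≤ δ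
  have hmono : ∀ {F F' δ δ' f}, F ⊆ F' → δ' ≤ δ → P F' δ' f → P F δ f := by
    rintro F F' δ δ' f hF hδ ⟨h1, h2, h3⟩
    exact ⟨h1, fun a ha => (h2 a (hF ha)).trans_le hδ, h3.trans hδ⟩
  let J : Set A := {a | ∀ η : ℝ, 0 < η → ∃ (F : Finset A) (δ : ℝ), 0 < δ ∧
    ∀ f, P F δ f → ‖f * a‖ < η}
  let I : TwoSidedIdeal A := TwoSidedIdeal.mk' J
    (by intro η hη; exact ⟨∅, 1, one_pos, fun f _ => by simpa using hη⟩)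
    (by
      intro x y hx hy η hη
      obtain ⟨F1, d1, hd1, H1⟩ := hx (η / 2) (half_pos hη)
      obtain ⟨F2, d2, hd2, H2⟩ := hy (η / 2) (half_pos hη)
      refine ⟨F1 ∪ F2, min d1 d2, lt_min hd1 hd2, fun f hf => ?_⟩
      have e1 := H1 f (hmono Finset.subset_union_left (min_le_left _ _) hf)
      have e2 := H2 f (hmono Finset.subset_union_right (min_le_right _ _) hf)
      rw [mul_add]
      linarith [norm_add_le (f * x) (f * y)])
    (by
      intro x hx η hη
      obtain ⟨F1, d1, hd1, H1⟩ := hx η hη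
      exact ⟨F1, d1, hd1, fun f hf => by simpa using H1 f hf⟩)
    (by
      intro x y hy η hη
      obtain ⟨F1, d1, hd1, H1⟩ := hy (η / 2 / (‖x‖ + 1)) (by positivity)
      refine ⟨insert x F1, min d1 (η / 2 / (‖y‖ + 1)), lt_min hd1 (by positivity), fun f hf => ?_⟩
      have e1 := H1 f (hmono (Finset.subset_insert _ _) (min_le_left _ _) hf)
      have e2 := (hf.2.1 x (Finset.mem_insert_self _ _)).trans_le (min_le_right _ _)
      rw [lt_div_iff₀ (by positivity)] at e1 e2
      have e : f * (x * y) = (f * x - x * f) * y + x * (f * y) := by noncomm_ring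
      rw [e]
      have := norm_add_le ((f * x - x * f) * y) (x * (f * y))
      have := norm_mul_le (f * x - x * f) y
      have := norm_mul_le x (f * y)
      have := norm_nonneg (f * y)
      have := norm_nonneg (f * x - x * f)
      nlinarith)
    (by
      intro x y hx η hη
      obtain ⟨F1, d1, hd1, H1⟩ := hx (η / (‖y‖ + 1)) (by positivity)
      refine ⟨F1, d1, hd1, fun f hf => ?_⟩
      have e1 := H1 f hf
      rw [lt_div_iff₀ (by positivity)] at e1
      rw [← mul_assoc]
      have := norm_mul_le (f * x) y
      have := norm_nonneg (f * x)
      nlinarith)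
  have hI : (I : Set A) = J := TwoSidedIdeal.coe_mk' _ _ _ _ _ _
  have hmem : ∀ a, a ∈ I ↔ a ∈ J := fun a => by rw [← hI]; rfl
  have hclosed : IsClosed (I : Set A) := by
    rw [hI]
    refine isClosed_of_closure_subset fun a ha η hη => ?_
    obtain ⟨b, hb, hab⟩ := Metric.mem_closure_iff.1 ha (η / 2) (half_pos hη)
    obtain ⟨F, δ, hδ, H⟩ := hb (η / 2) (half_pos hη)
    refine ⟨F, δ, hδ, fun f hf => ?_⟩
    have e1 := H f hf
    have e : f * a = f * (a - b) + f * b := by noncomm_ring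
    rw [dist_eq_norm] at hab
    have e2 := norm_mul_le f (a - b)
    rw [hf.1, one_mul] at e2
    rw [e]
    linarith [norm_add_le (f * (a - b)) (f * b)]
  have hkI : k ∈ I := by
    rw [hmem]
    intro η hη
    exact ⟨∅, η / 2, half_pos hη, fun f hf => by linarith [hf.2.2]⟩
  rcases hA I hclosed with h | h
  · rw [h, TwoSidedIdeal.mem_bot] at hkI
    exact absurd hkI hk
  · have h1 : (1 : A) ∈ I := by rw [h]; trivial
    rw [hmem] at h1
    obtain ⟨F, δ, hδ, H⟩ := h1 1 one_pos
    refine ⟨F, δ, hδ, fun f hf hc => ?_⟩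
    by_contra! hle
    have := H f ⟨hf, hc, hle⟩
    rw [mul_one, hf] at this
    exact lt_irrefl _ this

/-- A nonzero spectral piece of `x` near the top of the spectrum. -/
theorem exists_top_piece {x : A} (hx : 0 ≤ x) (hx1 : ‖x‖ = 1) {ε : ℝ} (h0 : 0 < ε) (h1 : ε < 1) :
    ∃ k : A, k ≠ 0 ∧ ∀ f : A, (1 - ε) * ‖f * k‖ ≤ ‖f * x * k‖ := by
  have : Nontrivial A := ⟨x, 0, fun h => by simp [h] at hx1⟩
  have hsa : IsSelfAdjoint x := .of_nonneg hx
  have hε : 0 < 1 - ε := by linarith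
  let u : ℝ → ℝ := fun t => max 0 (t - (1 - ε))
  let w : ℝ → ℝ := fun t => (max t (1 - ε))⁻¹
  have hw0 : ∀ t, 0 < max t (1 - ε) := fun t => hε.trans_le (le_max_right _ _)
  have hu : Continuous u := by fun_prop
  have hw : Continuous w := by
    refine Continuous.inv₀ (by fun_prop) fun t => (hw0 t).ne'
  refine ⟨cfc u x, ?_, fun f => ?_⟩
  · intro h
    have hm := CStarAlgebra.norm_mem_spectrum_of_nonneg hx
    rw [hx1] at hm
    have := norm_apply_le_norm_cfc u x hm hu.continuousOn hsa
    rw [h, norm_zero] at this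
    have h2 : u 1 = ε := by simp [u, h0.le]
    rw [h2, Real.norm_of_nonneg h0.le] at this
    linarith
  · have e : cfc u x = x * cfc u x * cfc w x := by
      have e0 : x * cfc u x = cfc (fun t => t * u t) x := by
        rw [cfc_mul (fun t => t) u x (by fun_prop) hu.continuousOn, cfc_id' ℝ x]
      rw [e0, ← cfc_mul _ w x (by fun_prop) hw.continuousOn]
      congr 1
      funext t
      simp only [u, w]
      rcases le_total t (1 - ε) with h | h
      · rw [max_eq_left (by linarith : t - (1 - ε) ≤ 0)]; simp
      · rw [max_eq_left h]
        have : t ≠ 0 := (hε.trans_le h).ne'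
        field_simp
    have hwn : ‖cfc w x‖ ≤ (1 - ε)⁻¹ := by
      refine norm_cfc_le (inv_nonneg.2 hε.le) fun t _ => ?_
      rw [Real.norm_of_nonneg (inv_nonneg.2 (hw0 t).le)]
      exact inv_anti₀ hε (le_max_right _ _)
    have h3 : ‖f * cfc u x‖ ≤ ‖f * x * cfc u x‖ * (1 - ε)⁻¹ := by
      calc ‖f * cfc u x‖ = ‖f * x * cfc u x * cfc w x‖ := by
            conv_lhs => rw [e]
            simp only [mul_assoc]
        _ ≤ ‖f * x * cfc u x‖ * ‖cfc w x‖ := norm_mul_le _ _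
        _ ≤ _ := by gcongr
    rw [← div_eq_mul_inv, le_div_iff₀ hε] at h3
    linarith

theorem norm_aut {φ : A ≃ₐ[ℂ] A} (h : ∀ a, φ (star a) = star (φ a)) (a : A) : ‖φ a‖ = ‖a‖ := by
  let ψ : A ≃⋆ₐ[ℂ] A :=
    { φ with
      map_star' := h
      map_smul' := fun r a => map_smul φ r a }
  exact StarAlgEquiv.norm_map ψ a

end RokhlinHelpers

theorem gen_of_weak
    {A G : Type*} [CStarAlgebra A] [PartialOrder A] [StarOrderedRing A]
    [Group G] [Fintype G] (α : G →* (A ≃ₐ[ℂ] A))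
    (hα : ∀ (g : G) (a : A), α g (star a) = star (α g a))
    (hW : HasWeakTracialRokhlin α) : HasGeneralizedTracialRokhlin α := by
  intro F ε hε x hx hx0
  have hxn : 0 < ‖x‖ := norm_pos_iff.2 hx0
  set e : ℝ := min (1 / 8) (ε / 10) with he
  have he0 : 0 < e := lt_min (by norm_num) (by positivity)
  have he1 : e ≤ 1 / 8 := min_le_left _ _
  have he2 : e ≤ ε / 10 := min_le_right _ _
  set y : A := ‖x‖⁻¹ • x with hy
  have hyn : ‖y‖ = 1 := by
    rw [hy, norm_smul, norm_inv, norm_norm, inv_mul_cancel₀ hxn.ne']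
  obtain ⟨f, f0, f1, fo, fc, fe, fC, fd⟩ := hW F e he0 y
    (smul_nonneg (inv_nonneg.2 hxn.le) hx) hyn
  have hf1 : ‖∑ g, f g‖ ≤ 1 := norm_sum_orth_le f0 zero_le_one f1 fo
  have hfl : 1 - e < ‖∑ g, f g‖ := by
    have a1 := norm_mul_le ((∑ g, f g) * y) (∑ g, f g)
    have a2 := norm_mul_le (∑ g, f g) y
    rw [hyn, mul_one] at a2
    have a3 := norm_nonneg (∑ g, f g)
    nlinarith
  obtain ⟨h0, hh0⟩ : ∃ h, 1 - e < ‖f h‖ := by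
    by_contra! hc
    have := norm_sum_orth_le f0 (by linarith : (0 : ℝ) ≤ 1 - e) hc fo
    linarith
  have hlow : ∀ g, 1 - 2 * e < ‖f g‖ := by
    intro g
    have h1 := fe (g * h0⁻¹) h0
    rw [inv_mul_cancel_right] at h1
    have h2 := norm_sub_norm_le (α (g * h0⁻¹) (f h0)) (f g)
    rw [norm_aut (hα _)] at h2
    linarith
  have hpos : ∀ g, 0 < ‖f g‖ := fun g => by linarith [hlow g]
  let q : G → A := fun g => ‖f g‖⁻¹ • f g
  have q1 : ∀ g, ‖q g‖ = 1 := fun g => by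
    simp only [q]; rw [norm_smul, norm_inv, norm_norm, inv_mul_cancel₀ (hpos g).ne']
  have q0 : ∀ g, 0 ≤ q g := fun g => smul_nonneg (inv_nonneg.2 (hpos g).le) (f0 g)
  have qo : ∀ g h, g ≠ h → q g * q h = 0 := fun g h hgh => by
    simp only [q]; rw [smul_mul_smul_comm, fo g h hgh, smul_zero]
  have hinv : ∀ g, ‖f g‖⁻¹ ≤ 2 := fun g => by
    rw [inv_le_comm₀ (hpos g) two_pos]; linarith [hlow g]
  have hinv1 : ∀ g, 1 ≤ ‖f g‖⁻¹ := fun g => (one_le_inv₀ (hpos g)).2 (f1 g)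
  have qf : ∀ g, ‖q g - f g‖ ≤ 2 * e := fun g => by
    have : q g - f g = (1 - ‖f g‖) • q g := by
      simp only [q]
      rw [smul_smul, sub_mul, mul_inv_cancel₀ (hpos g).ne', one_mul, sub_smul, one_smul]
    rw [this, norm_smul, q1, mul_one, Real.norm_of_nonneg (by linarith [f1 g])]
    linarith [hlow g]
  refine ⟨q, q0, q1, qo, ?_, ?_, ?_⟩
  · intro g a ha
    have : q g * a - a * q g = ‖f g‖⁻¹ • (f g * a - a * f g) := by
      simp only [q]; rw [smul_mul_assoc, mul_smul_comm, smul_sub]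
    rw [this, norm_smul, Real.norm_of_nonneg (by linarith [hinv1 g])]
    have a1 := fc g a ha
    have a2 := mul_le_mul_of_nonneg_right (hinv g) (norm_nonneg (f g * a - a * f g))
    linarith
  · intro g h
    have e1 : α g (q h) - q (g * h) = α g (q h - f h) + (α g (f h) - f (g * h))
        - (q (g * h) - f (g * h)) := by rw [map_sub]; abel
    rw [e1]
    have a1 := norm_sub_le (α g (q h - f h) + (α g (f h) - f (g * h))) (q (g * h) - f (g * h))
    have a2 := norm_add_le (α g (q h - f h)) (α g (f h) - f (g * h))
    rw [norm_aut (hα _)] at a2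
    linarith [qf h, qf (g * h), fe g h]
  · have hC : CuntzSubeq (1 - ∑ g, q g) y := by
      refine cuntz_of_le ?_ ?_ fC
      · exact (norm_sub_one_le (Finset.sum_nonneg fun g _ => q0 g)
          (norm_sum_orth_le q0 zero_le_one (fun g => (q1 g).le) qo)).1
      · refine sub_le_sub_left (Finset.sum_le_sum fun g _ => ?_) _
        have : q g - f g = (‖f g‖⁻¹ - 1) • f g := by
          simp only [q]; rw [sub_smul, one_smul]
        rw [← sub_nonneg, this]
        exact smul_nonneg (by linarith [hinv1 g]) (f0 g)
    rw [cuntz_iff] at hC ⊢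
    intro η hη
    obtain ⟨v, hv⟩ := hC η hη
    refine ⟨Real.sqrt ‖x‖⁻¹ • v, ?_⟩
    have : (Real.sqrt ‖x‖⁻¹ • v) * x * star (Real.sqrt ‖x‖⁻¹ • v) = v * y * star v := by
      rw [star_smul, star_trivial, smul_mul_assoc, smul_mul_assoc, mul_smul_comm, smul_smul,
        Real.mul_self_sqrt (inv_nonneg.2 hxn.le), hy, mul_smul_comm, smul_mul_assoc]
    rw [this]
    exact hv

theorem weak_of_gen
    {A G : Type*} [CStarAlgebra A] [PartialOrder A] [StarOrderedRing A]
    (hA : ∀ I : TwoSidedIdeal A, IsClosed (I : Set A) → I = ⊥ ∨ I = ⊤)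
    [Group G] [Fintype G] (α : G →* (A ≃ₐ[ℂ] A))
    (hα : ∀ (g : G) (a : A), α g (star a) = star (α g a))
    (hW : HasGeneralizedTracialRokhlin α) : HasWeakTracialRokhlin α := by
  classical
  intro F ε hε x hx hx1
  have hx0 : x ≠ 0 := fun h => by simp [h] at hx1
  set e : ℝ := min (1 / 2) (ε / 3) with he
  have he0 : 0 < e := lt_min (by norm_num) (by positivity)
  have he1 : e ≤ 1 / 2 := min_le_left _ _
  have he2 : e ≤ ε / 3 := min_le_right _ _
  obtain ⟨k, hk0, hk⟩ := exists_top_piece hx hx1 he0 (by linarith)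
  obtain ⟨F0, δ, hδ, hlow⟩ := central_lower_bound hA hk0
  have hkn : 0 < ‖k‖ := norm_pos_iff.2 hk0
  -- the tolerance available relative to the lower bound
  set τ : ℝ := e * δ / (3 * ‖k‖) with hτ
  have hτ0 : 0 < τ := by positivity
  obtain ⟨j, hj⟩ := exists_nat_one_div_lt hτ0
  set m : ℕ := 2 * j + 1 with hm
  have hmτ : 1 / ((m : ℝ) + 1) < τ := by
    refine lt_of_le_of_lt ?_ hj
    apply one_div_le_one_div_of_le (by positivity)
    rw [hm]; push_cast; have : (0 : ℝ) ≤ j := Nat.cast_nonneg j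
    linarith
  have hm0 : (0 : ℝ) < m := by rw [hm]; positivity
  set N : ℝ := (Fintype.card G : ℝ) with hN
  have hN0 : 0 < N := by rw [hN]; exact_mod_cast Fintype.card_pos
  set ρ : ℝ := min (ε / (m + 1)) (min (τ / (N + 1)) (δ / (N + 1))) with hρ
  have hρ0 : 0 < ρ := lt_min (by positivity) (lt_min (by positivity) (by positivity))
  have hρ1 : (m : ℝ) * ρ < ε := by
    have : ρ ≤ ε / (m + 1) := min_le_left _ _
    rw [le_div_iff₀ (by positivity)] at this
    nlinarith
  have hρ2 : N * ρ < τ := by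
    have : ρ ≤ τ / (N + 1) := (min_le_right _ _).trans (min_le_left _ _)
    rw [le_div_iff₀ (by positivity)] at this
    nlinarith
  have hρ3 : N * ρ < δ := by
    have : ρ ≤ δ / (N + 1) := (min_le_right _ _).trans (min_le_right _ _)
    rw [le_div_iff₀ (by positivity)] at this
    nlinarith
  obtain ⟨f, f0, f1, fo, fc, fe, fC⟩ := hW (insert x (F ∪ F0)) ρ hρ0 x hx hx0
  set s : A := ∑ g, f g with hs
  have s0 : 0 ≤ s := Finset.sum_nonneg fun g _ => f0 g
  have s1 : ‖s‖ ≤ 1 := norm_sum_orth_le f0 zero_le_one (fun g => (f1 g).le) fo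
  have s1' : ‖s‖ = 1 := by
    refine le_antisymm s1 ?_
    rw [← f1 1]
    exact CStarAlgebra.norm_le_norm_of_nonneg_of_le (f0 1)
      (Finset.single_le_sum (fun g _ => f0 g) (Finset.mem_univ 1))
  have sc : ∀ a ∈ insert x (F ∪ F0), ‖s * a - a * s‖ ≤ N * ρ := by
    intro a ha
    rw [hs, Finset.sum_mul, Finset.mul_sum, ← Finset.sum_sub_distrib]
    refine (norm_sum_le_of_le _ fun g _ => (fc g a ha).le).trans ?_
    simp [hN]
  have hsk : δ < ‖s * k‖ := hlow s s1' fun a ha =>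
    (sc a (Finset.mem_insert_of_mem (Finset.mem_union_right _ ha))).trans_lt hρ3
  have sx : ‖s * x - x * s‖ < τ := (sc x (Finset.mem_insert_self _ _)).trans_lt hρ2
  have hp := fun g => norm_sub_one_le (f0 g) (f1 g).le
  have hpm := fun g => pow_contr (hp g).1 (hp g).2 m
  have hq := fun g => norm_sub_one_le (hpm g).1 (hpm g).2
  have hS := norm_sub_one_le s0 s1
  have hSm := pow_contr hS.1 hS.2 m
  have hφ := norm_sub_one_le hSm.1 hSm.2
  have hsum := sum_q fo m
  refine ⟨fun g => 1 - (1 - f g) ^ m, fun g => (hq g).1, fun g => (hq g).2,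
    fun g h hgh => orth_q (fo g h hgh) m, ?_, ?_, ?_, ?_⟩
  · intro g a ha
    have h1 := comm_pow_le (hp g).1 (hp g).2 a m
    have h2 : (1 - f g) * a - a * (1 - f g) = -(f g * a - a * f g) := by noncomm_ring
    have h3 : (1 - (1 - f g) ^ m) * a - a * (1 - (1 - f g) ^ m)
        = -((1 - f g) ^ m * a - a * (1 - f g) ^ m) := by noncomm_ring
    rw [h2, norm_neg] at h1
    rw [h3, norm_neg]
    have h4 := fc g a (Finset.mem_insert_of_mem (Finset.mem_union_left _ ha))
    nlinarith
  · intro g h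
    have h1 : α g (1 - (1 - f h) ^ m) - (1 - (1 - f (g * h)) ^ m)
        = -((α g (1 - f h)) ^ m - (1 - f (g * h)) ^ m) := by
      rw [map_sub, map_pow, map_one]; abel
    have h2 := pow_sub_pow_le (p := α g (1 - f h)) (by rw [norm_aut (hα g)]; exact (hp h).2)
      (hp (g * h)).1 (hp (g * h)).2 m
    have h3 : α g (1 - f h) - (1 - f (g * h)) = -(α g (f h) - f (g * h)) := by
      rw [map_sub, map_one]; abel
    rw [h3, norm_neg] at h2
    rw [h1, norm_neg]
    have h4 := fe g h
    nlinarith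
  · rw [hsum, sub_sub_cancel]
    have h1 : (1 - s) ^ m = (1 - s) ^ j * (1 - s) * star ((1 - s) ^ j) := by
      rw [star_pow, (IsSelfAdjoint.of_nonneg hS.1).star_eq, ← pow_succ, ← pow_add, hm]
      congr 1; ring
    rw [h1]
    exact cuntz_conj fC
  · rw [hsum]
    set r : A := (1 - s) ^ m with hr
    have hrs : ‖r * s‖ < τ := (norm_pow_mul_le s0 s1 m).trans_lt hmτ
    set φ : A := 1 - r with hφd
    have hkey : s * x * k = φ * x * φ * (s * k) + φ * x * (r * s) * k
        + φ * (s * x - x * s) * k + (r * s) * x * k := by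
      have : φ * s = s - r * s := by rw [hφd]; noncomm_ring
      have e1 : φ * x * φ * (s * k) = φ * x * (s - r * s) * k := by
        rw [← this]; noncomm_ring
      have e2 : s * x * k = φ * s * x * k + r * s * x * k := by
        rw [this]; noncomm_ring
      rw [e1, e2]; noncomm_ring
    have b1 : ‖φ * x * φ * (s * k)‖ ≤ ‖φ * x * φ‖ * ‖s * k‖ := norm_mul_le _ _
    have b2 : ‖φ * x * (r * s) * k‖ ≤ τ * ‖k‖ := by
      calc _ ≤ ‖φ * x * (r * s)‖ * ‖k‖ := norm_mul_le _ _
        _ ≤ (‖φ‖ * ‖x‖ * ‖r * s‖) * ‖k‖ := by gcongr; exact norm_mul₃_le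
        _ ≤ (1 * 1 * τ) * ‖k‖ := by gcongr; exacts [hφ.2, hx1.le]
        _ = _ := by ring
    have b3 : ‖φ * (s * x - x * s) * k‖ ≤ τ * ‖k‖ := by
      calc _ ≤ ‖φ‖ * ‖s * x - x * s‖ * ‖k‖ := norm_mul₃_le
        _ ≤ (1 * τ) * ‖k‖ := by gcongr; exact hφ.2
        _ = _ := by ring
    have b4 : ‖(r * s) * x * k‖ ≤ τ * ‖k‖ := by
      calc _ ≤ ‖r * s‖ * ‖x‖ * ‖k‖ := norm_mul₃_le
        _ ≤ (τ * 1) * ‖k‖ := by gcongr; exact hx1.le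
        _ = _ := by ring
    have hτk : 3 * (τ * ‖k‖) = e * δ := by rw [hτ]; field_simp
    have hkk := hk s
    rw [hkey] at hkk
    have c1 := norm_add_le (φ * x * φ * (s * k) + φ * x * (r * s) * k
        + φ * (s * x - x * s) * k) ((r * s) * x * k)
    have c2 := norm_add_le (φ * x * φ * (s * k) + φ * x * (r * s) * k)
      (φ * (s * x - x * s) * k)
    have c3 := norm_add_le (φ * x * φ * (s * k)) (φ * x * (r * s) * k)
    have c4 : (1 - e) * ‖s * k‖ ≤ ‖φ * x * φ‖ * ‖s * k‖ + e * δ := by linarith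
    have c5 : e * δ < e * ‖s * k‖ := by gcongr
    have c6 : (1 - 2 * e) * ‖s * k‖ < ‖φ * x * φ‖ * ‖s * k‖ := by linarith
    have c7 := lt_of_mul_lt_mul_right c6 (norm_nonneg _)
    linarith

theorem generalizedTracialRokhlin_iff_weakTracialRokhlin
    {A G : Type*} [CStarAlgebra A] [PartialOrder A] [StarOrderedRing A]
    (hA : ∀ I : TwoSidedIdeal A, IsClosed (I : Set A) → I = ⊥ ∨ I = ⊤)
    [Group G] [Fintype G] (α : G →* (A ≃ₐ[ℂ] A))
    (hα : ∀ (g : G) (a : A), α g (star a) = star (α g a)) :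
    HasGeneralizedTracialRokhlin α ↔ HasWeakTracialRokhlin α := by
  exact ⟨weak_of_gen hA α hα, gen_of_weak α hα⟩
end

section
/- Let A be a simple infinite-dimensional unital C*-algebra which is not purely infinite, let G be a finite group, and let α : G → Aut(A) be an action of G on A. Suppose that for every finite subset F ⊂ A, every ε > 0, and every nonzero positive x ∈ A, there exist pairwise orthogonal positive contractions f_g ∈ A (g ∈ G) such that, with f = Σ_{g∈G} f_g: (1) ‖f_g a − a f_g‖ < ε for all g ∈ G and all a ∈ F; (2) ‖α_g(f_h) − f_{gh}‖ < ε for all g, h ∈ G; (3) 1 − f ≾ x. Then α has the weak tracial Rokhlin property. -/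
open Filter Topology

/-- A simple unital C*-algebra is purely infinite if it is infinite-dimensional and
every nonzero element is "one-sided invertible up to multiplication": `∃ u v, u * a * v = 1`. -/
def PurelyInfinite (A : Type*) [CStarAlgebra A] : Prop :=
  ¬ FiniteDimensional ℂ A ∧ ∀ a : A, a ≠ 0 → ∃ u v : A, u * a * v = 1

section helpers

variable {A : Type*} [CStarAlgebra A]

/-- In a simple unital C*-algebra a nonzero element generates everything algebraically. -/
lemma exists_sum_eq_one
    (hA : ∀ I : TwoSidedIdeal A, IsClosed (I : Set A) → I = ⊥ ∨ I = ⊤)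
    (d : A) (hd : d ≠ 0) :
    ∃ (n : ℕ) (u v : Fin n → A), ∑ i, u i * d * v i = 1 := by
  set S : Set A := {z | ∃ (n : ℕ) (u v : Fin n → A), ∑ i, u i * d * v i = z} with hS
  have h0 : (0 : A) ∈ S := ⟨0, Fin.elim0, Fin.elim0, by simp⟩
  have hadd : ∀ x ∈ S, ∀ y ∈ S, x + y ∈ S := by
    rintro x ⟨n, u, v, rfl⟩ y ⟨m, u', v', rfl⟩
    exact ⟨n + m, Fin.append u u', Fin.append v v', by simp [Fin.sum_univ_add]⟩
  have hl : ∀ a, ∀ x ∈ S, a * x ∈ S := by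
    rintro a x ⟨n, u, v, rfl⟩
    exact ⟨n, fun i => a * u i, v, by simp [Finset.mul_sum, mul_assoc]⟩
  have hr : ∀ a, ∀ x ∈ S, x * a ∈ S := by
    rintro a x ⟨n, u, v, rfl⟩
    exact ⟨n, u, fun i => v i * a, by simp [Finset.sum_mul, mul_assoc]⟩
  have hneg : ∀ x ∈ S, -x ∈ S := by
    intro x hx
    simpa using hl (-1) x hx
  have hdS : d ∈ S := ⟨1, fun _ => 1, fun _ => 1, by simp⟩
  let I : TwoSidedIdeal A := TwoSidedIdeal.mk' (closure S) (subset_closure h0)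
    (fun {x y} hx hy => map_mem_closure₂ continuous_add hx hy hadd)
    (fun {x} hx => map_mem_closure continuous_neg hx hneg)
    (fun {x y} hy => map_mem_closure (continuous_const_mul x) hy (hl x))
    (fun {x y} hx => map_mem_closure (f := fun x => x * y) (continuous_mul_const y) hx (hr y))
  have hI : (I : Set A) = closure S := TwoSidedIdeal.coe_mk' _ _ _ _ _ _
  have h1 : (1 : A) ∈ closure S := by
    rcases hA I (by rw [hI]; exact isClosed_closure) with h | h
    · exfalso
      have : d ∈ I := by
        rw [← SetLike.mem_coe, hI]; exact subset_closure hdS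
      rw [h] at this
      exact hd (by simpa using this)
    · rw [← hI, h]; simp
  obtain ⟨z, hz, hz1⟩ := Metric.mem_closure_iff.1 h1 1 one_pos
  have hu : IsUnit z := by
    have := isUnit_one_sub_of_norm_lt_one (x := 1 - z) (by rwa [dist_eq_norm] at hz1)
    simpa using this
  obtain ⟨w, hw⟩ := hu.exists_right_inv
  have := hr w z hz
  rw [hw] at this
  exact this

lemma finiteDimensional_of_minimal (p : A)
    (hp : ∀ a, ∃ c : ℂ, p * a * p = c • p)
    (n : ℕ) (u v : Fin n → A) (h1 : ∑ i, u i * p * v i = 1) : FiniteDimensional ℂ A := by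
  classical
  choose c hc using hp
  refine ⟨Finset.univ.image (fun ij : Fin n × Fin n => u ij.1 * p * v ij.2), ?_⟩
  rw [eq_top_iff]
  intro a _
  have : a = ∑ i, ∑ j, c (v i * a * u j) • (u i * p * v j) := by
    calc a = (∑ i, u i * p * v i) * a * (∑ j, u j * p * v j) := by rw [h1]; simp
      _ = ∑ i, ∑ j, c (v i * a * u j) • (u i * p * v j) := by
        rw [Finset.sum_mul, Finset.sum_mul]
        refine Finset.sum_congr rfl fun i _ => ?_
        rw [Finset.mul_sum]
        refine Finset.sum_congr rfl fun j _ => ?_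
        calc _ = u i * (p * (v i * a * u j) * p) * v j := by simp only [mul_assoc]
          _ = _ := by rw [hc]; simp
  rw [this]
  refine Submodule.sum_mem _ fun i _ => Submodule.sum_mem _ fun j _ => Submodule.smul_mem _ _ ?_
  exact Submodule.subset_span (by simp)

lemma cfc_ne_zero_of_mem {f : ℝ → ℝ} {z : A} (hz : IsSelfAdjoint z) (hf : Continuous f)
    {t : ℝ} (ht : t ∈ spectrum ℝ z) (h : f t ≠ 0) : cfc f z ≠ 0 := by
  intro h0
  have : cfc f z = cfc (fun _ => (0 : ℝ)) z := by rw [h0]; simp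
  exact h (eqOn_of_cfc_eq_cfc this (ha := hz) (hf := hf.continuousOn) (hg := continuousOn_const) ht)

variable [PartialOrder A] [StarOrderedRing A]

lemma exists_split
    (hA : ∀ I : TwoSidedIdeal A, IsClosed (I : Set A) → I = ⊥ ∨ I = ⊤)
    (hdim : ¬ FiniteDimensional ℂ A) (y : A) (hy : 0 ≤ y) (hy0 : y ≠ 0) :
    ∃ b c : A, 0 ≤ b ∧ 0 ≤ c ∧ b ≠ 0 ∧ c ≠ 0 ∧ b * c = 0 ∧ (∃ t, b = y * t) ∧ ∃ t, c = y * t := by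
  by_contra hcon
  have hysa : IsSelfAdjoint y := IsSelfAdjoint.of_nonneg hy
  -- Claim 1
  have key : ∀ z w : A, IsSelfAdjoint z → IsSelfAdjoint w → (∃ t, z = y * t) → (∃ t, w = y * t) →
      z * w = 0 → z = 0 ∨ w = 0 := by
    rintro z w hz hw ⟨t, ht⟩ ⟨s, hs⟩ hzw
    by_contra! hne
    refine hcon ⟨z * z, w * w, ?_, ?_, ?_, ?_, ?_, ⟨t * z, ?_⟩, ⟨s * w, ?_⟩⟩
    · have := star_mul_self_nonneg z; rwa [hz.star_eq] at this
    · have := star_mul_self_nonneg w; rwa [hw.star_eq] at this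
    · intro h
      exact hne.1 ((CStarRing.star_mul_self_eq_zero_iff z).1 (by rwa [hz.star_eq]))
    · intro h
      exact hne.2 ((CStarRing.star_mul_self_eq_zero_iff w).1 (by rwa [hw.star_eq]))
    · calc z * z * (w * w) = z * (z * w) * w := by simp only [mul_assoc]
        _ = 0 := by rw [hzw]; simp
    · rw [← mul_assoc, ← ht]
    · rw [← mul_assoc, ← hs]
  have key2 : ∀ z : A, IsSelfAdjoint z → (∃ t, z = y * t) → ∃ μ : ℝ, z * z = μ • z := by
    rintro z hz ⟨t, ht⟩
    have hsp : ∀ l ∈ spectrum ℝ z, ∀ m ∈ spectrum ℝ z, l ≠ 0 → m ≠ 0 → l = m := by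
      intro l hl m hm hl0 hm0
      by_contra hlm
      let φ : ℝ → ℝ → ℝ := fun a x => x * max 0 (|l - m| / 2 - |x - a|)
      have hφc : ∀ a, Continuous (φ a) := fun a => by fun_prop
      have hφ : ∀ a, a ∈ spectrum ℝ z → a ≠ 0 → cfc (φ a) z ≠ 0 := by
        intro a ha ha0
        refine cfc_ne_zero_of_mem hz (hφc a) ha ?_
        have : 0 < |l - m| / 2 := by
          have := abs_pos.2 (sub_ne_zero.2 hlm); linarith
        simp [φ, ha0]
        exact sub_ne_zero.2 hlm
      have hzφ : ∀ a, ∃ t, z * cfc (φ a) z = y * t := fun a => ⟨t * cfc (φ a) z, by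
        rw [← mul_assoc, ← ht]⟩
      have hid : z = cfc (fun x : ℝ => x) z := (cfc_id' ℝ z).symm
      have hprod : ∀ a, z * cfc (φ a) z = cfc (fun x => x * φ a x) z := by
        intro a
        rw [cfc_mul (fun x => x) (φ a) z (by fun_prop) (hφc a).continuousOn, cfc_id' ℝ z]
      have hne : ∀ a, a ∈ spectrum ℝ z → a ≠ 0 → z * cfc (φ a) z ≠ 0 := by
        intro a ha ha0
        rw [hprod]
        refine cfc_ne_zero_of_mem hz (continuous_id.mul (hφc a)) ha ?_
        have : 0 < |l - m| := abs_pos.2 (sub_ne_zero.2 hlm)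
        simp [φ, ha0]
        exact sub_ne_zero.2 hlm
      have hsa : ∀ a, IsSelfAdjoint (z * cfc (φ a) z) := by
        intro a; rw [hprod]; exact cfc_predicate _ _
      rcases key _ _ (hsa l) (hsa m) (hzφ l) (hzφ m) (by
        rw [hprod, hprod, ← cfc_mul (fun x => x * φ l x) (fun x => x * φ m x) z
          (continuous_id.mul (hφc l)).continuousOn (continuous_id.mul (hφc m)).continuousOn]
        have : (fun x => x * φ l x * (x * φ m x)) = fun _ => (0 : ℝ) := by
          funext x
          have h3 : |l - m| ≤ |x - l| + |x - m| := by
            have := abs_sub_le l x m; rwa [abs_sub_comm l x] at this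
          rcases le_total (|l - m| / 2) |x - l| with h | h
          · simp [φ, max_eq_left (sub_nonpos.2 h)]
          · have : |l - m| / 2 ≤ |x - m| := by linarith
            simp [φ, max_eq_left (sub_nonpos.2 this)]
        rw [this]; simp) with h | h
      · exact hne l hl hl0 h
      · exact hne m hm hm0 h
    have : ∃ μ : ℝ, ∀ l ∈ spectrum ℝ z, l * l = μ * l := by
      by_cases h : ∃ m ∈ spectrum ℝ z, m ≠ 0
      · obtain ⟨m, hm, hm0⟩ := h
        refine ⟨m, fun l hl => ?_⟩
        by_cases hl0 : l = 0
        · simp [hl0]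
        · rw [hsp l hl m hm hl0 hm0]
      · push Not at h
        exact ⟨0, fun l hl => by simp [h l hl]⟩
    obtain ⟨μ, hμ⟩ := this
    refine ⟨μ, ?_⟩
    calc z * z = cfc (fun x : ℝ => x * x) z := by
          rw [cfc_mul (fun x : ℝ => x) (fun x => x) z, cfc_id' ℝ z]
      _ = cfc (fun x : ℝ => μ * x) z := cfc_congr hμ
      _ = μ • z := by rw [cfc_const_mul μ (fun x : ℝ => x) z, cfc_id' ℝ z]
  obtain ⟨l, hl⟩ := key2 y hysa ⟨1, by simp⟩
  have hl0 : l ≠ 0 := by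
    rintro rfl
    apply hy0
    rw [← CStarRing.star_mul_self_eq_zero_iff, hysa.star_eq, hl, zero_smul]
  -- the minimal projection is `p`
  set p : A := l⁻¹ • y with hp
  have hpp : p * p = p := by
    rw [hp, smul_mul_smul_comm, hl, smul_smul]
    congr 1; field_simp
  have hpsa : IsSelfAdjoint p := (IsSelfAdjoint.all (l⁻¹)).smul hysa
  have hp0 : p ≠ 0 := smul_ne_zero (inv_ne_zero hl0) hy0
  have hpy : ∀ a, ∃ t, p * a = y * t := fun a => ⟨l⁻¹ • a, by simp [hp]⟩
  have hsmin : ∀ s : A, IsSelfAdjoint s → ∃ c : ℝ, p * s * p = c • p := by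
    intro s hs
    have hzs : IsSelfAdjoint (p * s * p) := by
      have := hs.conjugate p; rwa [hpsa.star_eq] at this
    obtain ⟨μ, hμ⟩ := key2 (p * s * p) hzs (by rw [mul_assoc]; exact hpy _)
    rcases key (p * s * p) (μ • p - p * s * p) hzs
      (((IsSelfAdjoint.all μ).smul hpsa).sub hzs) (by rw [mul_assoc]; exact hpy _) (by
        have : μ • p - p * s * p = p * (μ • 1 - s * p) := by simp [mul_sub, mul_assoc]
        rw [this]; exact hpy _) (by
        rw [mul_sub, hμ, mul_smul_comm, mul_assoc (p * s) p p, hpp, sub_self]) with h | h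
    · exact ⟨0, by simp [h]⟩
    · exact ⟨μ, (sub_eq_zero.1 h).symm⟩
  have hmin : ∀ a : A, ∃ c : ℂ, p * a * p = c • p := by
    intro a
    obtain ⟨r, hr⟩ := hsmin (realPart a) (realPart a).2
    obtain ⟨s, hs⟩ := hsmin (imaginaryPart a) (imaginaryPart a).2
    refine ⟨r + Complex.I * s, ?_⟩
    conv_lhs => rw [← realPart_add_I_smul_imaginaryPart a]
    rw [mul_add, add_mul, hr, mul_smul_comm Complex.I p, smul_mul_assoc Complex.I, hs, add_smul, mul_smul]
    simp
  obtain ⟨n, u, v, h1⟩ := exists_sum_eq_one hA p hp0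
  exact hdim (finiteDimensional_of_minimal p hmin n u v h1)

lemma exists_orthogonal
    (hA : ∀ I : TwoSidedIdeal A, IsClosed (I : Set A) → I = ⊥ ∨ I = ⊤)
    (hdim : ¬ FiniteDimensional ℂ A) (n : ℕ) : ∀ (y : A), 0 ≤ y → y ≠ 0 →
    ∃ s t : Fin n → A, (∀ i, 0 ≤ s i) ∧ (∀ i, s i ≠ 0) ∧ (∀ i j, i ≠ j → s i * s j = 0) ∧
      ∀ i, s i = y * t i := by
  induction n with
  | zero => intro y _ _; exact ⟨Fin.elim0, Fin.elim0, by simp, by simp, by simp, by simp⟩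
  | succ n ih =>
    intro y hy hy0
    obtain ⟨b, c, hb, hc, hb0, hc0, hbc, ⟨tb, htb⟩, ⟨tc, htc⟩⟩ := exists_split hA hdim y hy hy0
    obtain ⟨s, t, hs, hs0, hss, hst⟩ := ih b hb hb0
    have hcb : c * b = 0 := by
      have := congrArg star hbc
      rwa [star_mul, (IsSelfAdjoint.of_nonneg hb).star_eq,
        (IsSelfAdjoint.of_nonneg hc).star_eq, star_zero] at this
    have hcs : ∀ i, c * s i = 0 := fun i => by rw [hst, ← mul_assoc, hcb, zero_mul]
    have hsc : ∀ i, s i * c = 0 := fun i => by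
      have := congrArg star (hcs i)
      rwa [star_mul, (IsSelfAdjoint.of_nonneg (hs i)).star_eq,
        (IsSelfAdjoint.of_nonneg hc).star_eq, star_zero] at this
    refine ⟨Fin.cons c s, Fin.cons tc (fun i => tb * t i), ?_, ?_, ?_, ?_⟩
    · intro i; refine Fin.cases ?_ (fun i => ?_) i <;> simp [hc, hs]
    · intro i; refine Fin.cases ?_ (fun i => ?_) i <;> simp [hc0, hs0]
    · intro i j
      refine Fin.cases ?_ (fun i => ?_) i <;> refine Fin.cases ?_ (fun j => ?_) j
      · simp
      · simp [hcs]
      · simp [hsc]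
      · intro h
        simpa using hss i j (fun h' => h (by rw [h']))
    · intro i; refine Fin.cases ?_ (fun i => ?_) i
      · simpa using htc
      · simp [hst i, htb, mul_assoc]

lemma exists_small
    (hA : ∀ I : TwoSidedIdeal A, IsClosed (I : Set A) → I = ⊥ ∨ I = ⊤)
    (hdim : ¬ FiniteDimensional ℂ A) (hpi : ¬ PurelyInfinite A)
    (d x : A) (hd : d ≠ 0) (hx : 0 ≤ x) (hx0 : x ≠ 0) :
    ∃ y : A, 0 ≤ y ∧ y ≠ 0 ∧ (∃ v, y = v * x * star v) ∧
      ¬ ∀ η : ℝ, 0 < η → ∃ u v : A, ‖d - u * y * v‖ < η := by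
  by_contra! hcon
  have hA1 : Nontrivial A := ⟨d, 0, hd⟩
  -- the bad element
  have : ∃ a : A, a ≠ 0 ∧ ∀ u v : A, u * a * v ≠ 1 := by
    by_contra! h
    exact hpi ⟨hdim, h⟩
  obtain ⟨a₀, ha₀, hbad₀⟩ := this
  set a := star a₀ * a₀ with ha_def
  have ha : 0 ≤ a := star_mul_self_nonneg a₀
  have ha0 : a ≠ 0 := fun h => ha₀ ((CStarRing.star_mul_self_eq_zero_iff a₀).1 h)
  have hbad : ∀ u v : A, u * a * v ≠ 1 := fun u v h => hbad₀ (u * star a₀) v (by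
    rw [← h, ha_def]; simp only [mul_assoc])
  have hasa : IsSelfAdjoint a := IsSelfAdjoint.of_nonneg ha
  set δ := ‖a‖ / 2 with hδ
  have hna : 0 < ‖a‖ := norm_pos_iff.2 ha0
  have hδ0 : 0 < δ := by positivity
  set h : A := cfc (fun t : ℝ => (max t δ)⁻¹) a with hh
  set y₀ : A := cfc (fun t : ℝ => max (t - δ) 0) a with hy₀
  have hcont : Continuous (fun t : ℝ => (max t δ)⁻¹) :=
    Continuous.inv₀ (by fun_prop) (fun t => (lt_of_lt_of_le hδ0 (le_max_right t δ)).ne')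
  have hunit : a * h * y₀ = y₀ := by
    calc a * h * y₀ = cfc (fun t : ℝ => t * (max t δ)⁻¹ * max (t - δ) 0) a := by
          rw [cfc_mul (fun t : ℝ => t * (max t δ)⁻¹) (fun t => max (t - δ) 0) a
            (continuous_id.mul hcont).continuousOn (by fun_prop),
            cfc_mul (fun t : ℝ => t) (fun t => (max t δ)⁻¹) a (by fun_prop) hcont.continuousOn,
            cfc_id' ℝ a]
      _ = y₀ := by
        refine cfc_congr fun t _ => ?_
        rcases le_total t δ with ht | ht
        · simp [max_eq_right (sub_nonpos.2 ht)]
        · have : t ≠ 0 := by linarith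
          simp [max_eq_left ht, this]
  have hy₀n : 0 ≤ y₀ := cfc_nonneg fun t _ => le_max_right _ _
  have hy₀0 : y₀ ≠ 0 := by
    refine cfc_ne_zero_of_mem hasa (by fun_prop)
      (CStarAlgebra.norm_mem_spectrum_of_nonneg ha) ?_
    have : 0 < ‖a‖ - δ := by rw [hδ]; linarith
    exact (lt_of_lt_of_le this (le_max_left _ _)).ne'
  obtain ⟨n, u, v, huv⟩ := exists_sum_eq_one hA d hd
  obtain ⟨s, t, hs, hs0, hss, hst⟩ := exists_orthogonal hA hdim n y₀ hy₀n hy₀0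
  have hssa : ∀ i, star (s i) = s i := fun i => (IsSelfAdjoint.of_nonneg (hs i)).star_eq
  have hxsa : star x = x := (IsSelfAdjoint.of_nonneg hx).star_eq
  have hes : ∀ i, a * h * s i = s i := fun i => by rw [hst, ← mul_assoc, hunit]
  obtain ⟨m, u', v', huv'⟩ := exists_sum_eq_one hA x hx0
  have hc : ∀ i, ∃ c, x * c * (s i * s i) ≠ 0 := by
    intro i
    by_contra! hc
    have hz : s i * s i = 0 := by
      calc s i * s i = (∑ j, u' j * x * v' j) * (s i * s i) := by rw [huv', one_mul]
        _ = ∑ j, u' j * (x * v' j * (s i * s i)) := by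
          rw [Finset.sum_mul]; simp only [mul_assoc]
        _ = 0 := by simp [hc]
    exact hs0 i ((CStarRing.star_mul_self_eq_zero_iff (s i)).1 (by rwa [hssa]))
  choose c hc using hc
  set r := CFC.sqrt x with hr
  have hrr : r * r = x := CFC.sqrt_mul_sqrt_self x hx
  have hrsa : star r = r := (IsSelfAdjoint.of_nonneg (CFC.sqrt_nonneg x)).star_eq
  set w : Fin n → A := fun i => x * c i * (s i * s i) with hw
  set S : ℝ := ∑ i, ‖u i‖ * ‖v i‖ with hS
  have hS0 : 0 ≤ S := Finset.sum_nonneg fun i _ => by positivity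
  have hex : ∀ i, ∃ p q : A, ‖d - p * (star (w i) * w i) * q‖ < 1 / (S + 1) := by
    intro i
    refine hcon (star (w i) * w i) (star_mul_self_nonneg _)
      (fun h0 => hc i ((CStarRing.star_mul_self_eq_zero_iff (w i)).1 h0))
      ⟨s i * s i * star (c i) * r, ?_⟩ _ (by positivity)
    simp only [hw, star_mul, hssa, hxsa, hrsa, star_star]
    rw [← hrr]
    simp only [mul_assoc]
  choose p q hpq using hex
  set U := ∑ i, u i * p i * s i with hU
  set V := ∑ j, s j * (star (c j) * x * w j * q j * v j) with hV
  have hUV : U * V = ∑ i, u i * (p i * (star (w i) * w i) * q i) * v i := by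
    rw [hU, hV, Finset.sum_mul]
    refine Finset.sum_congr rfl fun i _ => ?_
    rw [Finset.mul_sum, Finset.sum_eq_single i]
    · have : star (w i) = s i * s i * star (c i) * x := by
        simp only [hw, star_mul, hssa, hxsa, mul_assoc]
      rw [this]
      simp only [mul_assoc]
    · intro j _ hj
      calc u i * p i * s i * (s j * (star (c j) * x * w j * q j * v j))
          = u i * p i * (s i * s j) * (star (c j) * x * w j * q j * v j) := by
            simp only [mul_assoc]
        _ = 0 := by rw [hss i j hj.symm]; simp
    · simp
  have hnear : ‖1 - U * V‖ < 1 := by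
    have : 1 - U * V = ∑ i, u i * (d - p i * (star (w i) * w i) * q i) * v i := by
      rw [hUV, ← huv, ← Finset.sum_sub_distrib]
      refine Finset.sum_congr rfl fun i _ => ?_
      rw [mul_sub, sub_mul]
    rw [this]
    calc _ ≤ ∑ i, ‖u i * (d - p i * (star (w i) * w i) * q i) * v i‖ := norm_sum_le _ _
      _ ≤ ∑ i, ‖u i‖ * ‖v i‖ * (1 / (S + 1)) := by
        refine Finset.sum_le_sum fun i _ => ?_
        calc _ ≤ ‖u i‖ * ‖d - p i * (star (w i) * w i) * q i‖ * ‖v i‖ := norm_mul₃_le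
          _ ≤ ‖u i‖ * (1 / (S + 1)) * ‖v i‖ := by
            gcongr; exact (hpq i).le
          _ = _ := by ring
      _ = S / (S + 1) := by rw [← Finset.sum_mul]; ring
      _ < 1 := by rw [div_lt_one (by positivity)]; linarith
  have hunitUV : IsUnit (U * V) := by
    simpa using isUnit_one_sub_of_norm_lt_one hnear
  obtain ⟨k, hk⟩ := hunitUV.exists_right_inv
  have heV : a * h * V = V := by
    rw [hV, Finset.mul_sum]
    refine Finset.sum_congr rfl fun i _ => ?_
    rw [← mul_assoc, hes]
  apply hbad U (h * V * k)
  calc U * a * (h * V * k) = U * (a * h * V) * k := by simp only [mul_assoc]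
    _ = 1 := by rw [heV, hk]

end helpers

theorem weakTracialRokhlin_of_not_purelyInfinite
    {A G : Type*} [CStarAlgebra A] [PartialOrder A] [StarOrderedRing A]
    (hA : ∀ I : TwoSidedIdeal A, IsClosed (I : Set A) → I = ⊥ ∨ I = ⊤)
    (hdim : ¬ FiniteDimensional ℂ A) (hpi : ¬ PurelyInfinite A)
    [Group G] [Fintype G] (α : G →* (A ≃ₐ[ℂ] A))
    (hα : ∀ (g : G) (a : A), α g (star a) = star (α g a))
    (hyp : ∀ (F : Finset A) (ε : ℝ), 0 < ε → ∀ x : A, 0 ≤ x → x ≠ 0 →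
      ∃ f : G → A,
        (∀ g, 0 ≤ f g) ∧ (∀ g, ‖f g‖ ≤ 1) ∧
        (∀ g h, g ≠ h → f g * f h = 0) ∧
        (∀ g, ∀ a ∈ F, ‖f g * a - a * f g‖ < ε) ∧
        (∀ g h, ‖α g (f h) - f (g * h)‖ < ε) ∧
        CuntzSubeq ((1 : A) - ∑ g, f g) x) :
    HasWeakTracialRokhlin α := by
  intro F ε hε x hx hx1
  have hx0 : x ≠ 0 := by rintro rfl; simp at hx1
  have hA1 : Nontrivial A := ⟨x, 0, hx0⟩
  have hxsa : IsSelfAdjoint x := IsSelfAdjoint.of_nonneg hx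
  set d : A := cfc (fun t : ℝ => max (t - (1 - ε / 2)) 0) x with hd
  have hdsa : IsSelfAdjoint d := cfc_predicate _ _
  have hd0 : d ≠ 0 := by
    refine cfc_ne_zero_of_mem hxsa (by fun_prop)
      (CStarAlgebra.norm_mem_spectrum_of_nonneg hx) ?_
    have : 0 < ‖x‖ - (1 - ε / 2) := by rw [hx1]; linarith
    exact (lt_of_lt_of_le this (le_max_left _ _)).ne'
  have hdd0 : d * d ≠ 0 := fun h =>
    hd0 ((CStarRing.star_mul_self_eq_zero_iff d).1 (by rwa [hdsa.star_eq]))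
  obtain ⟨y, hy, hy0, ⟨v, hv⟩, hsmall⟩ := exists_small hA hdim hpi (d * d) x hdd0 hx hx0
  obtain ⟨f, hf0, hf1, hff, hfF, hfα, ⟨w, hw⟩⟩ := hyp F ε hε y hy hy0
  refine ⟨f, hf0, hf1, hff, hfF, hfα, ⟨fun n => w n * v, ?_⟩, ?_⟩
  · refine hw.congr fun n => ?_
    rw [hv]; simp only [star_mul, mul_assoc]
  by_contra! hle
  apply hsmall
  set s := ∑ g, f g with hs
  have hssa : IsSelfAdjoint s := IsSelfAdjoint.of_nonneg (Finset.sum_nonneg fun g _ => hf0 g)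
  set r := CFC.sqrt x with hr
  have hrr : r * r = x := CFC.sqrt_mul_sqrt_self x hx
  have hrsa : star r = r := (IsSelfAdjoint.of_nonneg (CFC.sqrt_nonneg x)).star_eq
  set φ : A := cfc (fun t : ℝ => max (1 - ε / 2 - t) 0) x with hφ
  have hφd : φ * d = 0 := by
    rw [hφ, hd, ← cfc_mul _ _ x (by fun_prop) (by fun_prop)]
    have : (fun t : ℝ => max (1 - ε / 2 - t) 0 * max (t - (1 - ε / 2)) 0) = fun _ => 0 := by
      funext t
      rcases le_total t (1 - ε / 2) with ht | ht
      · rw [max_eq_right (sub_nonpos.2 ht), mul_zero]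
      · rw [max_eq_right (sub_nonpos.2 ht), zero_mul]
    rw [this]; simp
  have h1 : algebraMap ℝ A (1 - ε / 2) ≤ x + φ := by
    have : x + φ = cfc (fun t : ℝ => t + max (1 - ε / 2 - t) 0) x := by
      rw [cfc_add x (fun t : ℝ => t) (fun t => max (1 - ε / 2 - t) 0) (by fun_prop) (by fun_prop),
        cfc_id' ℝ x]
    rw [this]
    refine algebraMap_le_cfc _ _ x (fun t _ => ?_) (by fun_prop) hxsa
    have := le_max_left (1 - ε / 2 - t) 0
    linarith
  have h2 : r * s * s * r ≤ algebraMap ℝ A (1 - ε) := by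
    have e1 : star (s * r) * (s * r) = r * s * s * r := by
      rw [star_mul, hrsa, hssa.star_eq]; simp only [mul_assoc]
    have e2 : ‖s * r‖ ^ 2 = ‖s * x * s‖ := by
      rw [sq, ← CStarRing.norm_self_mul_star, star_mul, hrsa, hssa.star_eq, ← hrr]
      simp only [mul_assoc]
    rw [← e1]
    refine (CStarAlgebra.star_mul_le_algebraMap_norm_sq).trans ?_
    rw [e2]
    exact algebraMap_mono A hle
  set E : A := r * (1 + s) * (1 - s) * r with hE
  have hE' : E = x - r * s * s * r := by
    rw [hE, ← hrr]; noncomm_ring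
  have h3 : algebraMap ℝ A (ε / 2) ≤ E + φ := by
    have : algebraMap ℝ A (ε / 2) = algebraMap ℝ A (1 - ε / 2) - algebraMap ℝ A (1 - ε) := by
      rw [← map_sub]; congr 1; ring
    rw [this]
    calc _ ≤ (x + φ) - r * s * s * r := sub_le_sub h1 h2
      _ = E + φ := by rw [hE']; abel
  have hunit : IsUnit (E + φ) := by
    refine CStarAlgebra.isUnit_of_le _ h3 ?_
    exact (IsStrictlyPositive.iff_of_unital).2 ⟨algebraMap_nonneg A (by positivity),
      (isUnit_iff_ne_zero.2 (by positivity : ε / 2 ≠ 0)).map (algebraMap ℝ A)⟩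
  obtain ⟨Z, hZ⟩ := hunit.exists_left_inv
  have hdd : d * d = (d * Z * r * (1 + s)) * (1 - s) * (r * d) := by
    calc d * d = d * (Z * (E + φ)) * d := by rw [hZ, mul_one]
      _ = d * Z * E * d + d * Z * (φ * d) := by noncomm_ring
      _ = _ := by rw [hφd, hE]; simp only [mul_assoc, mul_zero, add_zero]
  set P := d * Z * r * (1 + s) with hP
  set Q := r * d with hQ
  intro η hη
  have hlim : Tendsto (fun n => ‖P‖ * ‖1 - s - w n * y * star (w n)‖ * ‖Q‖) atTop (𝓝 0) := by
    simpa using (hw.const_mul ‖P‖).mul_const ‖Q‖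
  obtain ⟨n, hn⟩ := (hlim.eventually (gt_mem_nhds hη)).exists
  refine ⟨P * w n, star (w n) * Q, lt_of_le_of_lt ?_ hn⟩
  rw [hdd]
  calc _ = ‖P * (1 - s - w n * y * star (w n)) * Q‖ := by
        congr 1; noncomm_ring
    _ ≤ _ := norm_mul₃_le
end
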